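/- arXiv:1911.08574 — 2 statements merged into one kernel-verified Lean document; each statement's English description precedes it below -/
import Mathlib

section
/- Let V be a variety of monoids all of whose members are aperiodic and suppose the monoid S(xyx) does not belong to V. If V is not hereditarily finitely based (i.e., some subvariety of V is not finitely based), then V satisfies the identity xyx ≈ xyx² or the identity xyx ≈ x²yx. -/
open FreeMonoid

/-- Words over the countably infinite alphabet `ℕ`. -/
abbrev Word : Type := FreeMonoid ℕ

/-- The word corresponding to a list of letters. -/
def wd (l : List ℕ) : Word := FreeMonoid.ofList l

/-- A monoid `M` satisfies the identity `e.1 ≈ e.2`. -/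
def MSat (M : Type*) [Monoid M] (e : Word × Word) : Prop :=
  ∀ φ : Word →* M, φ e.1 = φ e.2

/-- A monoid `M` satisfies every identity of `S`. -/
def SatAll (M : Type*) [Monoid M] (S : Set (Word × Word)) : Prop :=
  ∀ e ∈ S, MSat M e

/-- The varieties `Mod S` and `Mod T` coincide (they have exactly the same members). -/
def VarEq.{u} (S T : Set (Word × Word)) : Prop :=
  ∀ (M : Type u) [Monoid M], SatAll M S ↔ SatAll M T

/-- The variety `Mod S` is finitely based. -/
def FinitelyBased.{u} (S : Set (Word × Word)) : Prop :=
  ∃ T : Finset (Word × Word), VarEq.{u} S (↑T)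

/-- `G` is a subgroup (a subsemigroup which is a group) of the monoid `M`. -/
def IsSubgroupIn (M : Type*) [Monoid M] (G : Set M) : Prop :=
  (∀ a ∈ G, ∀ b ∈ G, a * b ∈ G) ∧
    ∃ e ∈ G, (∀ g ∈ G, e * g = g ∧ g * e = g) ∧ ∀ g ∈ G, ∃ h ∈ G, g * h = e ∧ h * g = e

/-- A monoid is aperiodic if all its subgroups have exactly one element. -/
def AperiodicMonoid (M : Type*) [Monoid M] : Prop :=
  ∀ G : Set M, IsSubgroupIn M G → ∀ a ∈ G, ∀ b ∈ G, a = b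

/-- The idempotents of `M` commute. -/
def CommIdem (M : Type*) [Monoid M] : Prop :=
  ∀ e f : M, e * e = e → f * f = f → e * f = f * e

/-- `w` is a factor (contiguous subword) of some word of `W`. -/
def IsFactorIn (W : Set (List ℕ)) (w : List ℕ) : Prop := ∃ s ∈ W, w <:+: s

theorem IsFactorIn.left {W : Set (List ℕ)} {u v : List ℕ} (h : IsFactorIn W (u ++ v)) :
    IsFactorIn W u := by
  obtain ⟨s, hs, hf⟩ := h
  exact ⟨s, hs, (List.prefix_append u v).isInfix.trans hf⟩

theorem IsFactorIn.right {W : Set (List ℕ)} {u v : List ℕ} (h : IsFactorIn W (u ++ v)) :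
    IsFactorIn W v := by
  obtain ⟨s, hs, hf⟩ := h
  exact ⟨s, hs, (List.suffix_append u v).isInfix.trans hf⟩

/-- The Rees congruence on the free monoid identifying all non-factors of words of `W`. -/
def reesCon (W : Set (List ℕ)) : Con Word where
  r u v := u = v ∨ (¬ IsFactorIn W (toList u) ∧ ¬ IsFactorIn W (toList v))
  iseqv := ⟨fun _ => Or.inl rfl, fun h => by tauto, fun h₁ h₂ => by
    rcases h₁ with rfl | h₁ <;> rcases h₂ with rfl | h₂ <;> tauto⟩
  mul' := by
    rintro w x y z (rfl | ⟨hw, hx⟩) (rfl | ⟨hy, hz⟩)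
    · exact Or.inl rfl
    · refine Or.inr ⟨fun h => hy ?_, fun h => hz ?_⟩
      · rw [toList_mul] at h; exact h.right
      · rw [toList_mul] at h; exact h.right
    · refine Or.inr ⟨fun h => hw ?_, fun h => hx ?_⟩
      · rw [toList_mul] at h; exact h.left
      · rw [toList_mul] at h; exact h.left
    · refine Or.inr ⟨fun h => hw ?_, fun h => hx ?_⟩
      · rw [toList_mul] at h; exact h.left
      · rw [toList_mul] at h; exact h.left

/-- The Rees quotient `S(W)` of the free monoid over the ideal of all words that
are not factors of any word in `W`. -/
abbrev SMon (W : Set (List ℕ)) : Type := (reesCon W).Quotient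

/-- The equational theory of the monoid `N`; `Mod (Th N)` is the variety generated by `N`. -/
def Th (N : Type*) [Monoid N] : Set (Word × Word) := {e | MSat N e}

/-- The reverse of a word. -/
def revW (w : Word) : Word := ofList (toList w).reverse

/-- The set of identities defining the dual variety. -/
def dualSet (S : Set (Word × Word)) : Set (Word × Word) :=
  (fun e : Word × Word => (revW e.1, revW e.2)) '' S

/-- letters: x = 0, y = 1, z = 2, t = 3. -/
def Oset : Set (Word × Word) :=
  {(wd [0,0,1,1], wd [1,1,0,0]), (wd [0,2,0,1,0,3,1], wd [0,2,1,0,3,1])}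

def Kset : Set (Word × Word) :=
  {(wd [0,1,0], wd [0,1,0,0]), (wd [0,0,1,1], wd [1,1,0,0]), (wd [0,0,1], wd [0,0,1,0])}

def Qset : Set (Word × Word) :=
  {(wd [0,1,0], wd [0,1,0,0]), (wd [0,0,1,1], wd [1,1,0,0]), (wd [0,1,0], wd [0,0,1,0])}

def Eset : Set (Word × Word) :=
  {(wd [0,0,1,1], wd [1,1,0,0]), (wd [0,0], wd [0,0,0]), (wd [1,0,0], wd [0,1,0])}

def F0set : Set (Word × Word) :=
  {(wd [0,1,0], wd [0,1,0,0]), (wd [0,0,1,1], wd [1,1,0,0]),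
   (wd [0,1,2,0,1], wd [1,0,2,0,1]), (wd [0,0,1], wd [0,0,1,0])}

/-- The identity `x z_{π(1)}⋯z_{π(n)} x (t₁z₁)⋯(tₙzₙ) ≈ x² z_{π(1)}⋯z_{π(n)} (t₁z₁)⋯(tₙzₙ)`,
with letters `x = 0`, `zᵢ = 2i+1`, `tᵢ = 2i+2`. -/
def Jscheme (n : ℕ) (π : Equiv.Perm (Fin n)) : Word × Word :=
  (of 0 * ((List.finRange n).map fun i => of (2 * (π i : ℕ) + 1)).prod * of 0 *
      ((List.finRange n).map fun i => of (2 * (i : ℕ) + 2) * of (2 * (i : ℕ) + 1)).prod,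
   of 0 * of 0 * ((List.finRange n).map fun i => of (2 * (π i : ℕ) + 1)).prod *
      ((List.finRange n).map fun i => of (2 * (i : ℕ) + 2) * of (2 * (i : ℕ) + 1)).prod)

/-- The defining identities of the variety `J`. -/
def Jset : Set (Word × Word) :=
  {(wd [0,1,0], wd [0,1,0,0]), (wd [0,0,1,1], wd [1,1,0,0]),
   (wd [0,1,2,0,1], wd [1,0,2,0,1]), (wd [0,1,0,2,3,0], wd [0,1,0,2,0,3,0])} ∪
  {e | ∃ n : ℕ, 1 ≤ n ∧ ∃ π : Equiv.Perm (Fin n), e = Jscheme n π}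

/-- The set of letters occurring in a word. -/
def conL (w : List ℕ) : Set ℕ := {a | a ∈ w}

/-- The set of simple letters of a word. -/
def simpleSet (w : List ℕ) : Set ℕ := {a | w.count a = 1}

/-- The set of multiple letters of a word. -/
def mulSet (w : List ℕ) : Set ℕ := {a | 2 ≤ w.count a}

/-- The position of the `i`-th occurrence (`i ≥ 1`) of the letter `a` in `w`. -/
def nthOccIdx (w : List ℕ) (a : ℕ) (i : ℕ) : ℕ :=
  ((List.range w.length).filter fun j => w.getD j (a + 1) == a).getD (i - 1) w.length

/-- `h_i(w,a)`: the right-most divider (simple letter) of `w` preceding the `i`-th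
occurrence of `a` in `w`; `none` encodes the empty divider `t₀`. -/
def hdiv (w : List ℕ) (a : ℕ) (i : ℕ) : Option ℕ :=
  ((w.take (nthOccIdx w a i)).filter fun b => w.count b == 1).getLast?

/-- `t(w,a)`: the right-most divider of `w` preceding the last occurrence of `a` in `w`. -/
def tdiv (w : List ℕ) (a : ℕ) : Option ℕ := hdiv w a (w.count a)

/-- The word `b₀ t₁ b₁ t₂ b₂ ⋯ tₘ bₘ` built from blocks and dividers. -/
def assemble (b0 : List ℕ) (ps : List (ℕ × List ℕ)) : List ℕ :=
  b0 ++ (ps.map fun p => p.1 :: p.2).flatten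

/-- `t₀ b₀ t₁ b₁ ⋯ tₘ bₘ` is the decomposition of `w`: the `tᵢ` are the dividers
(simple letters) of `w` and the blocks `bᵢ` consist of multiple letters. -/
def IsDecomp (w b0 : List ℕ) (ps : List (ℕ × List ℕ)) : Prop :=
  w = assemble b0 ps ∧ (∀ p ∈ ps, w.count p.1 = 1) ∧
    (∀ a ∈ b0, 2 ≤ w.count a) ∧ ∀ p ∈ ps, ∀ a ∈ p.2, 2 ≤ w.count a

/-- The identity `u ≈ v` is well-balanced: `u` and `v` have the same dividers in the
same order and corresponding blocks have the same number of occurrences of each letter. -/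
def WellBalanced (u v : List ℕ) : Prop :=
  ∃ b0 ps c0 qs, IsDecomp u b0 ps ∧ IsDecomp v c0 qs ∧
    ps.map Prod.fst = qs.map Prod.fst ∧
    List.Forall₂ (fun b c : List ℕ => ∀ a, b.count a = c.count a)
      (b0 :: ps.map Prod.snd) (c0 :: qs.map Prod.snd)

/-- `∏_{i=a}^{b} tᵢ eᵢ` where `tᵢ = i+1`, `eᵢ = x = 0` for odd `i` and `eᵢ = y = 1`
for even `i`. -/
def prodTE (a b : ℕ) : Word :=
  ((List.range' a (b + 1 - a)).map fun i =>
    of (i + 1) * of (if i % 2 = 1 then 0 else 1)).prod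

def alphaId (n : ℕ) : Word × Word :=
  (wd [0,1] * prodTE 1 (n+1), wd [1,0] * prodTE 1 (n+1))

def betaId (n : ℕ) : Word × Word :=
  (wd [1,0,0] * prodTE 2 (n+1), wd [0,1,0] * prodTE 1 n)

def gammaId (n : ℕ) : Word × Word :=
  (wd [0,0,1] * prodTE 1 (n+1), wd [0,1,0] * prodTE 1 (n+1))

def gammaId' (n : ℕ) : Word × Word :=
  (wd [0,0,1] * prodTE 2 (n+1), wd [0,1,0] * prodTE 2 (n+1))

/-- The family `Φ` of identities from Lemma 3.5 (letters `x = 0`, `y = 1`, `t = 2`). -/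
def PhiSet : Set (Word × Word) :=
  {(wd [0,1,2,0,1], wd [1,0,2,0,1]), (wd [1,0,0,2,0,1], wd [0,1,0,2,0,1]),
   (wd [0,0,1,2,0,1], wd [0,1,0,2,0,1])} ∪
  {e | ∃ n : ℕ, 1 ≤ n ∧ (e = alphaId n ∨ e = betaId n ∨ e = gammaId n ∨ e = gammaId' n)}
universe uM


theorem msat_iff (M : Type*) [Monoid M] (u v : Word) :
    MSat M (u, v) ↔ ∀ f : ℕ → M, ((toList u).map f).prod = ((toList v).map f).prod := by
  constructor
  · intro h f
    have := h (FreeMonoid.lift f)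
    simpa [FreeMonoid.lift_apply] using this
  · intro h φ
    have := h (fun n => φ (of n))
    have e : φ = FreeMonoid.lift (fun n => φ (of n)) := by
      ext; simp
    rw [e]
    simpa [FreeMonoid.lift_apply] using this

/-- Semantic consequence. -/
def Cons.{u} (S : Set (Word × Word)) (l r : List ℕ) : Prop :=
  ∀ (M : Type u) [Monoid M], SatAll M S → ∀ f : ℕ → M, (l.map f).prod = (r.map f).prod

theorem prod_single {M : Type*} [Monoid M] (z : ℕ) (p : M) (l : List ℕ) :
    (l.map (fun n => if n = z then p else 1)).prod = p ^ l.count z := by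
  induction l with
  | nil => simp
  | cons a l ih =>
    by_cases h : a = z
    · subst h; simp [ih, pow_succ']
    · simp [ih, h]

theorem subgroup_pow {M : Type*} [Monoid M] (hM : AperiodicMonoid M) (a : M) (p d : ℕ)
    (hd : 1 ≤ d) (h : a ^ p = a ^ (p + d)) : a ^ p = a ^ (p + 1) := by
  have h1 : ∀ k, p ≤ k → a ^ (k + d) = a ^ k := by
    intro k hk
    obtain ⟨j, rfl⟩ := Nat.exists_eq_add_of_le hk
    rw [show p + j + d = (p + d) + j by ring, pow_add, ← h, pow_add]
  have h2 : ∀ m k, p ≤ k → a ^ (k + m * d) = a ^ k := by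
    intro m
    induction m with
    | zero => simp
    | succ m ih =>
      intro k hk
      rw [show k + (m + 1) * d = (k + m * d) + d by ring, h1 _ (by omega), ih k hk]
  have hpd : p ≤ p * d := Nat.le_mul_of_pos_right p hd
  refine hM {x | ∃ k, p ≤ k ∧ x = a ^ k} ⟨?_, a ^ (p * d), ⟨p * d, hpd, rfl⟩, ?_, ?_⟩ _
    ⟨p, le_rfl, rfl⟩ _ ⟨p + 1, by omega, rfl⟩
  · rintro _ ⟨k, hk, rfl⟩ _ ⟨l, hl, rfl⟩
    exact ⟨k + l, by omega, (pow_add ..).symm⟩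
  · rintro _ ⟨k, hk, rfl⟩
    rw [← pow_add, ← pow_add, add_comm (p * d) k, h2 _ _ hk]
    exact ⟨rfl, rfl⟩
  · rintro _ ⟨k, hk, rfl⟩
    refine ⟨a ^ (k * (d - 1) + p * d), ⟨_, by omega, rfl⟩, ?_⟩
    obtain ⟨c, rfl⟩ := Nat.exists_eq_add_of_le hd
    rw [← pow_add, ← pow_add, add_comm (k * (1 + c - 1) + p * (1 + c)) k]
    have : k + (k * (1 + c - 1) + p * (1 + c)) = p * (1 + c) + k * (1 + c) := by
      rw [Nat.add_sub_cancel_left]; ring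
    rw [this, h2 _ _ hpd]
    exact ⟨rfl, rfl⟩

theorem pow_step {M : Type*} [Monoid M] (hM : AperiodicMonoid M) (a : M) {p q : ℕ}
    (hpq : p < q) (h : a ^ p = a ^ q) : a ^ p = a ^ (p + 1) := by
  refine subgroup_pow hM a p (q - p) (by omega) ?_
  rw [h]; congr 1; omega

theorem exists_unbalanced (S : Set (Word × Word))
    (hap : ∀ (M : Type uM) [Monoid M], SatAll M S → AperiodicMonoid M) :
    ∃ N : ℕ, ∀ (M : Type uM) [Monoid M], SatAll M S → ∀ a : M, a ^ N = a ^ (N + 1) := by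
  have : ∃ e ∈ S, ∃ z, (toList e.1).count z ≠ (toList e.2).count z := by
    by_contra! hc
    have hs : SatAll (ULift.{uM} (Multiplicative ℤ)) S := by
      rintro ⟨u, v⟩ he
      rw [msat_iff]
      intro f
      exact ((List.perm_iff_count.2 (hc _ he)).map f).prod_eq
    have h := hap _ hs Set.univ ⟨fun _ _ _ _ => trivial, 1, trivial, by simp,
      fun g _ => ⟨g⁻¹, trivial, by simp⟩⟩ (ULift.up (Multiplicative.ofAdd 0)) trivial
      (ULift.up (Multiplicative.ofAdd 1)) trivial
    have h' := congrArg (fun t => Multiplicative.toAdd (ULift.down t)) h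
    simp at h'
  obtain ⟨⟨u, v⟩, he, z, hz⟩ := this
  have key : ∀ (M : Type uM) [Monoid M], SatAll M S → ∀ a : M,
      a ^ (toList u).count z = a ^ (toList v).count z := by
    intro M _ hM a
    have := (msat_iff M u v).1 (hM _ he) (fun n => if n = z then a else 1)
    rwa [prod_single, prod_single] at this
  rcases lt_or_gt_of_ne hz with h | h
  · exact ⟨_, fun M _ hM a => pow_step (hap M hM) a h (key M hM a)⟩
  · exact ⟨_, fun M _ hM a => pow_step (hap M hM) a h (key M hM a).symm⟩

theorem exists_xyx (S : Set (Word × Word)) (hSxyx : ¬ SatAll (SMon {[0,1,0]}) S) :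
    ∃ w : List ℕ, w ≠ [0,1,0] ∧ Cons.{uM} S [0,1,0] w := by
  have main : ∀ u v : Word, (∀ (M : Type uM) [Monoid M], SatAll M S → MSat M (u, v)) →
      ∀ g : Word →* Word, IsFactorIn {[0,1,0]} (toList (g u)) → g u ≠ g v →
      ∃ w : List ℕ, w ≠ [0,1,0] ∧ Cons.{uM} S [0,1,0] w := by
    rintro u v huv g ⟨s, hs, p, q, hpq⟩ hne
    rw [Set.mem_singleton_iff] at hs
    subst hs
    refine ⟨p ++ toList (g v) ++ q, ?_, ?_⟩
    · intro h
      rw [← hpq] at h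
      have := List.append_cancel_left (List.append_cancel_right h)
      exact hne (toList.injective this.symm)
    · intro M _ hM f
      have h := huv M hM ((FreeMonoid.lift f).comp g)
      simp only [MonoidHom.comp_apply, FreeMonoid.lift_apply] at h
      rw [← hpq]
      simp [h]
  unfold SatAll at hSxyx
  push Not at hSxyx
  obtain ⟨⟨u, v⟩, he, hn⟩ := hSxyx
  unfold MSat at hn
  push Not at hn
  obtain ⟨φ, hφ⟩ := hn
  have hsat : ∀ (M : Type uM) [Monoid M], SatAll M S → MSat M (u, v) := fun M _ hM => hM _ he
  choose r hr using fun n : ℕ => (Con.mk'_surjective (c := reesCon {[0,1,0]})) (φ (of n))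
  have hφe : φ = (reesCon {[0,1,0]}).mk'.comp (FreeMonoid.lift r) := by
    ext n; simpa using (hr n).symm
  have hrel : ¬ reesCon {[0,1,0]} (FreeMonoid.lift r u) (FreeMonoid.lift r v) := by
    intro h
    apply hφ
    rw [hφe]
    exact (Con.eq _).2 h
  have hrel' : ¬ (FreeMonoid.lift r u = FreeMonoid.lift r v ∨
      (¬ IsFactorIn {[0,1,0]} (toList (FreeMonoid.lift r u)) ∧
        ¬ IsFactorIn {[0,1,0]} (toList (FreeMonoid.lift r v)))) := hrel
  push Not at hrel'
  obtain ⟨h1, h2⟩ := hrel'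
  by_cases hf : IsFactorIn {[0,1,0]} (toList (FreeMonoid.lift r u))
  · exact main u v hsat _ hf h1
  · exact main v u (fun M _ hM φ => (hsat M hM φ).symm) _ (h2 hf) (Ne.symm h1)

/-! ### Varieties satisfying `xyx ≈ yx²` -/

theorem absorb {M : Type*} [Monoid M] (hM : ∀ x y : M, x * y * x = y * x * x)
    (f g h : ℕ → M) (a : ℕ) (k : ℕ) (hg : g a = f a ^ (k + 1)) (hh : h a = f a ^ (k + 2))
    (hgh : ∀ z, z ≠ a → g z = h z) (L : List ℕ) (hL : L.Nodup) (ha : a ∈ L) :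
    f a * (L.map g).prod = (L.map h).prod := by
  obtain ⟨A, B, rfl⟩ := List.append_of_mem ha
  rw [List.nodup_middle, List.nodup_cons, List.mem_append] at hL
  have hA : A.map g = A.map h := List.map_congr_left fun z hz => hgh z (by
    rintro rfl; exact hL.1 (Or.inl hz))
  have hB : B.map g = B.map h := List.map_congr_left fun z hz => hgh z (by
    rintro rfl; exact hL.1 (Or.inr hz))
  simp only [List.map_append, List.map_cons, List.prod_append, List.prod_cons, hA, hB, hg, hh]
  rw [pow_succ' (f a) k, show k + 2 = (k + 1) + 1 from rfl, pow_succ', pow_succ']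
  have := hM (f a) (A.map h).prod
  calc _ = (f a * (A.map h).prod * f a) * (f a ^ k * (B.map h).prod) := by simp only [mul_assoc]
    _ = _ := by rw [this]; simp only [mul_assoc]

theorem normal_form {M : Type*} [Monoid M] (hM : ∀ x y : M, x * y * x = y * x * x)
    (f : ℕ → M) (l : List ℕ) :
    (l.map f).prod = (l.dedup.map fun z => f z ^ l.count z).prod := by
  induction l with
  | nil => simp
  | cons a l ih =>
    rw [List.map_cons, List.prod_cons, ih]
    by_cases ha : a ∈ l
    · rw [List.dedup_cons_of_mem ha]
      have hc : 0 < l.count a := List.count_pos_iff.2 ha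
      refine absorb hM f _ _ a (l.count a - 1) ?_ ?_ ?_ _ (List.nodup_dedup l)
        (List.mem_dedup.2 ha)
      · congr 1; omega
      · simp only [List.count_cons_self]; congr 1; omega
      · intro z hz
        rw [List.count_cons_of_ne (Ne.symm hz)]
    · rw [List.dedup_cons_of_notMem ha, List.map_cons, List.prod_cons, List.count_cons_self,
        List.count_eq_zero_of_not_mem ha, zero_add, pow_one]
      congr 2
      refine List.map_congr_left fun z hz => ?_
      rw [List.count_cons_of_ne]
      rintro rfl
      exact ha (List.mem_dedup.1 hz)

theorem prod_two {M : Type*} [Monoid M] (h : ℕ → M) (x y : ℕ) (L : List ℕ) (hL : L.Nodup)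
    (hs : List.Sublist [x, y] L) (h1 : ∀ z, z ≠ x → z ≠ y → h z = 1) :
    (L.map h).prod = h x * h y := by
  have hf : ∀ K : List ℕ, (K.map h).prod = ((K.filter fun z => z = x ∨ z = y).map h).prod := by
    intro K
    induction K with
    | nil => simp
    | cons a K ih =>
      by_cases ha : a = x ∨ a = y
      · rw [List.filter_cons_of_pos (by simpa using ha)]; simp [ih]
      · rw [List.filter_cons_of_neg (by simpa using ha)]
        push Not at ha
        simp [ih, h1 a ha.1 ha.2]
  rw [hf L]
  have hs2 : List.Sublist [x, y] (L.filter (fun z => z = x ∨ z = y)) := by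
    have := hs.filter (fun z => decide (z = x ∨ z = y))
    simpa using this
  have hxy : x ≠ y := by
    have := hs.nodup hL
    simpa using this
  have hlen : (L.filter (fun z => z = x ∨ z = y)).length ≤ [x, y].length := by
    apply List.Subperm.length_le
    apply List.subperm_of_subset (hL.filter _)
    intro z hz
    simp at hz
    simp [hz.2]
  rw [← hs2.eq_of_length_le hlen]
  simp

theorem sort_eq {M : Type*} [Monoid M] (g : ℕ → M) (L1 : List ℕ) : ∀ L2 : List ℕ, L1.Nodup →
    L1.Perm L2 →
    (∀ x y, List.Sublist [x, y] L1 → List.Sublist [y, x] L2 → g x * g y = g y * g x) →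
    (L1.map g).prod = (L2.map g).prod := by
  induction L1 with
  | nil => intro L2 _ hp _; rw [List.nil_perm.1 hp]
  | cons x L ih =>
    intro L2 hn hp hc
    have hx : x ∈ L2 := hp.subset (by simp)
    obtain ⟨A, B, rfl⟩ := List.append_of_mem hx
    have hp2 : L.Perm (A ++ B) := (hp.trans List.perm_middle).cons_inv
    rw [List.map_cons, List.prod_cons, ih (A ++ B) hn.of_cons hp2]
    · have hcomm : Commute (g x) (A.map g).prod := by
        apply Commute.list_prod_right
        intro m hm
        obtain ⟨y, hy, rfl⟩ := List.mem_map.1 hm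
        apply hc x y
        · have : y ∈ L := hp2.symm.subset (by simp [hy])
          simpa using this
        · have h1 : List.Sublist [y] A := by simpa using hy
          have h2 : List.Sublist [x] (x :: B) := by simp
          exact h1.append h2
      simp only [List.map_append, List.prod_append, List.map_cons, List.prod_cons]
      rw [← mul_assoc, hcomm.eq, mul_assoc]
    · intro a b h1 h2
      refine hc a b (h1.trans (List.sublist_cons_self _ _)) (h2.trans ?_)
      exact (List.Sublist.refl A).append (List.sublist_cons_self _ _)

theorem prod_filter_of_one {M : Type*} [Monoid M] (g : ℕ → M) (p : ℕ → Prop) [DecidablePred p]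
    (L : List ℕ) (h : ∀ z ∈ L, ¬ p z → g z = 1) :
    (L.map g).prod = ((L.filter p).map g).prod := by
  induction L with
  | nil => simp
  | cons a K ih =>
    have ih := ih fun z hz => h z (List.mem_cons_of_mem _ hz)
    by_cases ha : p a
    · rw [List.filter_cons_of_pos (by simpa using ha)]; simp [ih]
    · rw [List.filter_cons_of_neg (by simpa using ha)]
      simp [ih, h a (by simp) ha]

theorem prod_pair {M : Type*} [Monoid M] (hM : ∀ x y : M, x * y * x = y * x * x)
    (x y : ℕ) (p q : M) (l : List ℕ) (hs : List.Sublist [x, y] l.dedup) :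
    (l.map (fun n => if n = x then p else if n = y then q else 1)).prod =
      p ^ l.count x * q ^ l.count y := by
  have hxy : x ≠ y := by
    have := hs.nodup (List.nodup_dedup l)
    simpa using this
  rw [normal_form hM, prod_two _ x y _ (List.nodup_dedup l) hs]
  · simp [hxy.symm]
  · intro z h1 h2
    simp [h1, h2]

theorem pow_min {M : Type*} [Monoid M] {N : ℕ} {a : M} (h : a ^ N = a ^ (N + 1)) (k : ℕ) :
    a ^ k = a ^ (min k N) := by
  rcases le_total k N with hk | hk
  · rw [min_eq_left hk]
  · rw [min_eq_right hk]
    induction k, hk using Nat.le_induction with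
    | base => rfl
    | succ k hk ih => rw [pow_succ, ih, ← pow_succ, ← h]

theorem finitelyBased_of_yxx (T : Set (Word × Word)) (N : ℕ)
    (h1 : ∀ (M : Type uM) [Monoid M], SatAll M T → ∀ x y : M, x * y * x = y * x * x)
    (h2 : ∀ (M : Type uM) [Monoid M], SatAll M T → ∀ x : M, x ^ N = x ^ (N + 1)) :
    FinitelyBased.{uM} T := by
  classical
  let P : Word × Word → Prop := fun e => ∀ (M : Type uM) [Monoid M], SatAll M T → MSat M e
  let T0 : Finset (Word × Word) :=
    ({(of 0 * of 1 * of 0, of 1 * of 0 * of 0), (of 0 ^ N, of 0 ^ (N + 1))} ∪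
    ((Finset.range (N + 1) ×ˢ Finset.range (N + 1)).image
      fun k => ((of 0 ^ k.1, of 0 ^ k.2) : Word × Word))) ∪
    ((Finset.range (N + 1) ×ˢ Finset.range (N + 1)).image
      fun k => ((of 0 ^ k.1 * of 1 ^ k.2, of 1 ^ k.2 * of 0 ^ k.1) : Word × Word))
  refine ⟨T0.filter P, fun M _ => ⟨fun hM e he => ?_, fun hM => ?_⟩⟩
  · simp only [Finset.coe_filter, Set.mem_ofPred_eq] at he
    exact he.2 M hM
  have hmem : ∀ e, e ∈ T0 → P e → MSat M e := fun e h h' =>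
    hM e (by simp only [Finset.coe_filter, Set.mem_ofPred_eq]; exact ⟨h, h'⟩)
  have lift2 : ∀ x y : M, ∃ φ : Word →* M, φ (of 0) = x ∧ φ (of 1) = y := fun x y =>
    ⟨FreeMonoid.lift (fun n => if n = 0 then x else y), by simp, by simp⟩
  have m1 : ∀ x y : M, x * y * x = y * x * x := by
    intro x y
    have := hmem (of 0 * of 1 * of 0, of 1 * of 0 * of 0) (by simp [T0]) (by
      intro M' _ hM' φ
      simpa using h1 M' hM' (φ (of 0)) (φ (of 1)))
    obtain ⟨φ, rfl, rfl⟩ := lift2 x y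
    simpa using this φ
  have m2 : ∀ x : M, x ^ N = x ^ (N + 1) := by
    intro x
    have := hmem (of 0 ^ N, of 0 ^ (N + 1)) (by simp [T0]) (by
      intro M' _ hM' φ
      simpa using h2 M' hM' (φ (of 0)))
    obtain ⟨φ, rfl, -⟩ := lift2 x x
    simpa using this φ
  have m3 : ∀ k l : ℕ, (∀ (M' : Type uM) [Monoid M'], SatAll M' T → ∀ x : M', x ^ k = x ^ l) →
      ∀ x : M, x ^ k = x ^ l := by
    intro k l h x
    have := hmem (of 0 ^ (min k N), of 0 ^ (min l N)) (by
        apply Finset.mem_union_left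
        apply Finset.mem_union_right
        refine Finset.mem_image.2 ⟨(min k N, min l N), ?_, rfl⟩
        simp) (by
      intro M' _ hM' φ
      simp only [map_pow]
      rw [← pow_min (h2 M' hM' _), ← pow_min (h2 M' hM' _)]
      exact h M' hM' _)
    obtain ⟨φ, rfl, -⟩ := lift2 x x
    rw [pow_min (m2 _) k, pow_min (m2 _) l]
    simpa only [map_pow] using this φ
  have m4 : ∀ k l : ℕ, (∀ (M' : Type uM) [Monoid M'], SatAll M' T → ∀ x y : M',
      x ^ k * y ^ l = y ^ l * x ^ k) → ∀ x y : M, x ^ k * y ^ l = y ^ l * x ^ k := by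
    intro k l h x y
    have := hmem (of 0 ^ (min k N) * of 1 ^ (min l N), of 1 ^ (min l N) * of 0 ^ (min k N)) (by
        apply Finset.mem_union_right
        refine Finset.mem_image.2 ⟨(min k N, min l N), ?_, rfl⟩
        simp) (by
      intro M' _ hM' φ
      simp only [map_pow, map_mul]
      rw [← pow_min (h2 M' hM' _), ← pow_min (h2 M' hM' _)]
      exact h M' hM' _ _)
    obtain ⟨φ, rfl, rfl⟩ := lift2 x y
    rw [pow_min (m2 _) k, pow_min (m2 _) l]
    simpa only [map_pow, map_mul] using this φ
  rintro ⟨u, v⟩ he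
  have hT : ∀ (M' : Type uM) [Monoid M'], SatAll M' T → ∀ f : ℕ → M',
      ((toList u).map f).prod = ((toList v).map f).prod := fun M' _ hM' =>
    (msat_iff M' u v).1 (hM' _ he)
  rw [msat_iff]
  intro f
  generalize toList u = u at hT ⊢
  generalize toList v = v at hT ⊢
  have c1 : ∀ z, ∀ (M' : Type uM) [Monoid M'], SatAll M' T → ∀ x : M',
      x ^ u.count z = x ^ v.count z := by
    intro z M' _ hM' x
    have := hT M' hM' (fun n => if n = z then x else 1)
    rwa [prod_single, prod_single] at this
  have c2 : ∀ x y, List.Sublist [x, y] u.dedup → List.Sublist [y, x] v.dedup →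
      ∀ (M' : Type uM) [Monoid M'], SatAll M' T → ∀ p q : M',
      p ^ u.count x * q ^ u.count y = q ^ u.count y * p ^ u.count x := by
    intro x y hu hv M' _ hM' p q
    have hxy : x ≠ y := by
      have := hu.nodup (List.nodup_dedup u)
      simpa using this
    have a1 := hT M' hM' (fun n => if n = x then p else if n = y then q else 1)
    rw [prod_pair (h1 M' hM') x y p q u hu] at a1
    have a2 : (fun n => if n = x then p else if n = y then q else 1) =
        (fun n => if n = y then q else if n = x then p else 1) := by
      funext n
      by_cases hn : n = x
      · subst hn; simp [hxy]
      · simp [hn]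
    rw [a2, prod_pair (h1 M' hM') y x q p v hv, ← c1 x M' hM', ← c1 y M' hM'] at a1
    exact a1
  rw [normal_form m1 f u, normal_form m1 f v]
  have hg : (fun z => f z ^ v.count z) = (fun z => f z ^ u.count z) := by
    funext z
    exact (m3 _ _ (c1 z) _).symm
  rw [hg, prod_filter_of_one _ (fun z => z ∈ v) u.dedup, prod_filter_of_one _ (fun z => z ∈ u) v.dedup]
  · apply sort_eq
    · exact (List.nodup_dedup u).filter _
    · refine (List.perm_ext_iff_of_nodup ((List.nodup_dedup u).filter _)
        ((List.nodup_dedup v).filter _)).2 fun z => ?_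
      simp [and_comm]
    · intro x y hx hy
      exact m4 _ _ (c2 x y (hx.trans List.filter_sublist) (hy.trans List.filter_sublist)) _ _
  · intro z _ hz
    rw [List.count_eq_zero_of_not_mem hz, pow_zero]
  · intro z _ hz
    rw [m3 _ _ (c1 z), List.count_eq_zero_of_not_mem hz, pow_zero]

/-! ### Duality -/

theorem msat_op (M : Type*) [Monoid M] (u v : Word) :
    MSat Mᵐᵒᵖ (u, v) ↔ MSat M (revW u, revW v) := by
  have key : ∀ (f : ℕ → M) (l : List ℕ),
      (l.map fun n => MulOpposite.op (f n)).prod = MulOpposite.op (l.reverse.map f).prod := by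
    intro f l
    induction l with
    | nil => simp
    | cons a l ih => simp [ih]
  rw [msat_iff, msat_iff]
  constructor
  · intro h f
    have := h (fun n => MulOpposite.op (f n))
    rw [key, key] at this
    exact MulOpposite.op_injective this
  · intro h f
    have := h (fun n => MulOpposite.unop (f n))
    have h' := congrArg MulOpposite.op this
    have k1 := key (fun n => MulOpposite.unop (f n)) (toList u)
    have k2 := key (fun n => MulOpposite.unop (f n)) (toList v)
    simp only [MulOpposite.op_unop] at k1 k2
    rw [k1, k2]
    exact h'

theorem satAll_dual (M : Type*) [Monoid M] (S : Set (Word × Word)) :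
    SatAll M (dualSet S) ↔ SatAll Mᵐᵒᵖ S := by
  constructor
  · rintro h ⟨u, v⟩ he
    exact (msat_op M u v).2 (h _ ⟨_, he, rfl⟩)
  · rintro h _ ⟨⟨u, v⟩, he, rfl⟩
    exact (msat_op M u v).1 (h _ he)

theorem satAll_opop (M : Type*) [Monoid M] (S : Set (Word × Word)) :
    SatAll Mᵐᵒᵖᵐᵒᵖ S ↔ SatAll M S := by
  have aux : ∀ u v : Word, MSat Mᵐᵒᵖᵐᵒᵖ (u, v) ↔ MSat M (u, v) := by
    intro u v
    rw [msat_op, msat_op]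
    simp [revW]
  exact ⟨fun h e he => (aux e.1 e.2).1 (h e he), fun h e he => (aux e.1 e.2).2 (h e he)⟩

theorem finitelyBased_of_xxy (T : Set (Word × Word)) (N : ℕ)
    (h1 : ∀ (M : Type uM) [Monoid M], SatAll M T → ∀ x y : M, x * y * x = x * x * y)
    (h2 : ∀ (M : Type uM) [Monoid M], SatAll M T → ∀ x : M, x ^ N = x ^ (N + 1)) :
    FinitelyBased.{uM} T := by
  classical
  have hd : FinitelyBased.{uM} (dualSet T) := by
    refine finitelyBased_of_yxx _ N (fun M _ hM x y => ?_) (fun M _ hM x => ?_)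
    · have := h1 Mᵐᵒᵖ ((satAll_dual M T).1 hM) (MulOpposite.op x) (MulOpposite.op y)
      apply MulOpposite.op_injective
      simpa [mul_assoc] using this
    · have := h2 Mᵐᵒᵖ ((satAll_dual M T).1 hM) (MulOpposite.op x)
      apply MulOpposite.op_injective
      simpa using this
  obtain ⟨T', hT'⟩ := hd
  refine ⟨T'.image (fun e : Word × Word => (revW e.1, revW e.2)), fun M _ => ?_⟩
  have a := hT' Mᵐᵒᵖ
  rw [satAll_dual, satAll_opop] at a
  rw [a, Finset.coe_image]
  exact (satAll_dual M _).symm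

/-- If `Mod S` consists of aperiodic monoids, does not contain `S(xyx)` and is not
hereditarily finitely based, then it satisfies `xyx ≈ xyx²` or `xyx ≈ x²yx`. -/
theorem satisfies_xyxx_or_xxyx_of_not_hfb (S : Set (Word × Word))
    (hap : ∀ (M : Type uM) [Monoid M], SatAll M S → AperiodicMonoid M)
    (hSxyx : ¬ SatAll (SMon {[0,1,0]}) S)
    (hnhfb : ∃ D : Set (Word × Word), ¬ FinitelyBased.{uM} (S ∪ D)) :
    (∀ (M : Type uM) [Monoid M], SatAll M S → MSat M (wd [0,1,0], wd [0,1,0,0])) ∨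
    (∀ (M : Type uM) [Monoid M], SatAll M S → MSat M (wd [0,1,0], wd [0,0,1,0])) := by
  obtain ⟨N, hN⟩ := exists_unbalanced S hap
  obtain ⟨w, hw, hc⟩ := exists_xyx.{uM} S hSxyx
  obtain ⟨D, hD⟩ := hnhfb
  have red : ∀ (M : Type uM) [Monoid M], SatAll M (S ∪ D) → SatAll M S :=
    fun M _ h e he => h e (Or.inl he)
  by_cases hidem : ∀ (M : Type uM) [Monoid M], SatAll M S → ∀ a : M, a = a * a
  · left
    intro M _ hM
    rw [msat_iff]
    intro f
    simp [wd, ← hidem M hM (f 0)]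
  have cz : ∀ z, ∀ (M : Type uM) [Monoid M], SatAll M S → ∀ a : M,
      a ^ ([0,1,0] : List ℕ).count z = a ^ w.count z := by
    intro z M _ hM a
    have := hc M hM (fun n => if n = z then a else 1)
    rwa [prod_single, prod_single] at this
  have low : ∀ p q : ℕ, p ≤ 1 → p < q → ¬ ∀ (M : Type uM) [Monoid M], SatAll M S →
      ∀ a : M, a ^ p = a ^ q := by
    intro p q hp hpq h
    apply hidem
    intro M _ hM a
    have := pow_step (hap M hM) a hpq (h M hM a)
    interval_cases p
    · simp at this; simp [← this]
    · simpa [pow_two] using this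
  have hz1 : ∀ z, ([0,1,0] : List ℕ).count z ≤ 1 → w.count z = ([0,1,0] : List ℕ).count z := by
    intro z hz
    by_contra hne
    rcases lt_or_gt_of_ne hne with h | h
    · exact low _ _ (by omega) h (fun M _ hM a => (cz z M hM a).symm)
    · exact low _ _ hz h (cz z)
  have h0 : 2 ≤ w.count 0 := by
    by_contra hlt
    refine low (w.count 0) (([0,1,0] : List ℕ).count 0) (by omega) ?_
      (fun M _ hM a => (cz 0 M hM a).symm)
    have : ([0,1,0] : List ℕ).count 0 = 2 := by decide
    omega
  have hone : w.count 1 = 1 := hz1 1 (by decide)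
  obtain ⟨A, B, rfl⟩ := List.append_of_mem (List.count_pos_iff.1 (by omega : 0 < w.count 1))
  have hmem : ∀ z ∈ A ++ B, z = 0 := by
    intro z hz
    by_contra hz0
    have hz2 : 0 < (A ++ B).count z := List.count_pos_iff.2 hz
    by_cases hz3 : z = 1
    · subst hz3
      rw [List.count_append] at hone hz2
      rw [List.count_cons_self] at hone
      omega
    · have hcnt : ([0,1,0] : List ℕ).count z = 0 := by
        apply List.count_eq_zero_of_not_mem; simp [hz0, hz3]
      have := hz1 z (by omega)
      rw [hcnt, List.count_eq_zero] at this
      apply this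
      rw [List.mem_append] at hz
      simp
      tauto
  obtain ⟨a, rfl⟩ : ∃ a, A = List.replicate a 0 :=
    ⟨_, List.eq_replicate_of_mem fun z hz => hmem z (List.mem_append_left _ hz)⟩
  obtain ⟨b, rfl⟩ : ∃ b, B = List.replicate b 0 :=
    ⟨_, List.eq_replicate_of_mem fun z hz => hmem z (List.mem_append_right _ hz)⟩
  have hab : (List.replicate a 0 ++ 1 :: List.replicate b 0).count 0 = a + b := by
    simp
  have key : ∀ (M : Type uM) [Monoid M], SatAll M S → ∀ x y : M,
      x * y * x = x ^ a * y * x ^ b := by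
    intro M _ hM x y
    have := hc M hM (fun n => if n = 0 then x else y)
    simpa [mul_assoc] using this
  have h2 := cz 0
  rw [hab] at h0 h2
  rcases Nat.lt_or_ge 2 (a + b) with h3 | h3
  · have sq : ∀ (M : Type uM) [Monoid M], SatAll M S → ∀ x : M, x ^ 2 = x ^ 3 := by
      intro M _ hM x
      exact pow_step (hap M hM) x h3 (h2 M hM x)
    have sq' : ∀ (M : Type uM) [Monoid M], SatAll M S → ∀ x : M, ∀ k, 2 ≤ k →
        x ^ k = x ^ (k + 1) := by
      intro M _ hM x k hk
      rw [pow_min (sq M hM x) k, pow_min (sq M hM x) (k + 1), min_eq_right hk,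
        min_eq_right (by omega)]
    by_cases ha : 2 ≤ a
    · right
      intro M _ hM
      rw [msat_iff]
      intro f
      have e : f 0 * f 1 * f 0 = f 0 * (f 0 * f 1 * f 0) := by
        rw [key M hM]
        conv_lhs => rw [sq' M hM _ a ha, pow_succ']
        simp only [mul_assoc]
      simpa [wd, mul_assoc] using e
    · left
      intro M _ hM
      rw [msat_iff]
      intro f
      have e : f 0 * f 1 * f 0 = (f 0 * f 1 * f 0) * f 0 := by
        rw [key M hM]
        conv_lhs => rw [sq' M hM _ b (by omega), pow_succ]
        simp only [mul_assoc]
      simpa [wd, mul_assoc] using e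
  · exfalso
    apply hD
    have hcase : (a = 2 ∧ b = 0) ∨ (a = 0 ∧ b = 2) ∨ (a = 1 ∧ b = 1) := by omega
    rcases hcase with ⟨rfl, rfl⟩ | ⟨rfl, rfl⟩ | ⟨rfl, rfl⟩
    · refine finitelyBased_of_xxy _ N (fun M _ hM x y => ?_) fun M _ hM => hN M (red M hM)
      simpa [pow_two] using key M (red M hM) x y
    · refine finitelyBased_of_yxx _ N (fun M _ hM x y => ?_) fun M _ hM => hN M (red M hM)
      simpa [pow_two, mul_assoc] using key M (red M hM) x y
    · exact absurd rfl hw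
end

section
/- The variety K = Mod{xyx ≈ xyx², x²y² ≈ y²x², x²y ≈ x²yx} is hereditarily finitely based: for every set Σ of identities there exists a finite set Σ′ of identities such that a monoid satisfies all identities of {xyx ≈ xyx², x²y² ≈ y²x², x²y ≈ x²yx} ∪ Σ if and only if it satisfies all identities of Σ′. -/
open FreeMonoid

universe uM

namespace KHFB

/-- Fully invariant congruences containing the identities of `K`. -/
structure FIC (θ : List ℕ → List ℕ → Prop) : Prop where
  refl : ∀ u, θ u u
  symm : ∀ {u v}, θ u v → θ v u
  trans : ∀ {u v w}, θ u v → θ v w → θ u w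
  mul : ∀ {u v} (p r), θ u v → θ (p ++ (u ++ r)) (p ++ (v ++ r))
  subst : ∀ (f : ℕ → List ℕ) {u v}, θ u v → θ (u.flatMap f) (v.flatMap f)
  k1 : ∀ x y : List ℕ, θ (x ++ (y ++ x)) (x ++ (y ++ (x ++ x)))
  k2 : ∀ x y : List ℕ, θ (x ++ (x ++ (y ++ y))) (y ++ (y ++ (x ++ x)))
  k3 : ∀ x y : List ℕ, θ (x ++ (x ++ y)) (x ++ (x ++ (y ++ x)))

/-- depth of the letter `a` (seen in the prefix `P`) is at least `k`. -/
def dge : ℕ → List ℕ → List ℕ → ℕ → Prop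
  | 0, _, _, _ => True
  | k + 1, P, r, a => ∃ q r2, r = q ++ r2 ∧ 2 ≤ (P ++ q).count a ∧
      ∀ b ∈ q, b ∉ P → dge k (P ++ q) r2 b

theorem dge_of_count {k P r a} (h : 2 ≤ P.count a) : dge k P r a := by
  cases k with
  | zero => trivial
  | succ k => exact ⟨[], r, by simp, by simpa using h, by simp⟩

theorem dge_mono {k P r a} (h : dge (k + 1) P r a) : dge k P r a := by
  induction k generalizing P r a with
  | zero => trivial
  | succ k ih =>
    obtain ⟨q, r2, h1, h2, h3⟩ := h
    exact ⟨q, r2, h1, h2, fun b hb hP => ih (h3 b hb hP)⟩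

theorem dge_le {j k P r a} (hjk : j ≤ k) (h : dge k P r a) : dge j P r a := by
  induction hjk with
  | refl => exact h
  | step _ ih => exact ih (dge_mono h)

theorem dge_shift {k P s r a} (h : dge k P (s ++ r) a) : dge k (P ++ s) r a := by
  cases k with
  | zero => trivial
  | succ k =>
    obtain ⟨q, r2, h1, h2, h3⟩ := h
    rcases List.append_eq_append_iff.1 h1 with ⟨t, rfl, rfl⟩ | ⟨t, rfl, rfl⟩
    · refine ⟨t, r2, rfl, by simpa using h2, fun b hb hP => ?_⟩
      have := h3 b (by simp [hb]) (by simp at hP; tauto)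
      simpa using this
    · refine dge_of_count (le_trans h2 ?_)
      simp

theorem dge_sub {k P P' r a} (hP : ∀ c, P.count c ≤ P'.count c) (h : dge k P r a) :
    dge k P' r a := by
  induction k generalizing P P' r a with
  | zero => trivial
  | succ k ih =>
    obtain ⟨q, r2, h1, h2, h3⟩ := h
    have hq : ∀ c, (P ++ q).count c ≤ (P' ++ q).count c := by
      intro c; simp [hP c]
    refine ⟨q, r2, h1, h2.trans (hq a), fun b hb hb' => ih hq (h3 b hb ?_)⟩
    intro hbP
    exact hb' (List.count_pos_iff.1 (lt_of_lt_of_le (List.count_pos_iff.2 hbP) (hP b)))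

theorem dge_unshift {k P q r a} (hq : ∀ c ∈ q, c ∉ P → dge k (P ++ q) r c)
    (h : dge (k + 1) (P ++ q) r a) : dge (k + 1) P (q ++ r) a := by
  obtain ⟨q', r2, h1, h2, h3⟩ := h
  refine ⟨q ++ q', r2, by simp [h1], by simpa using h2, fun b hb hP => ?_⟩
  by_cases hbq : b ∈ q
  · have := hq b hbq hP
    rw [h1] at this
    simpa using dge_shift this
  · have := h3 b (by simp at hb; tauto) (by simp; tauto)
    simpa using this

/-- Variant: both levels equal. -/
theorem dge_unshift' {k P q r a} (hq : ∀ c ∈ q, c ∉ P → dge k (P ++ q) r c)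
    (h : dge k (P ++ q) r a) : dge k P (q ++ r) a := by
  cases k with
  | zero => trivial
  | succ k => exact dge_unshift (fun c hc hc' => dge_mono (hq c hc hc')) h

theorem dge_split {k P r} (W : List ℕ) (h : ∀ a ∈ W, dge (k + 1) P r a) :
    ∃ q r2, r = q ++ r2 ∧ (∀ a ∈ W, 2 ≤ (P ++ q).count a) ∧
      ∀ b ∈ q, b ∉ P → dge k (P ++ q) r2 b := by
  induction W with
  | nil => exact ⟨[], r, by simp⟩
  | cons a W ih =>
    obtain ⟨q, r2, h1, h2, h3⟩ := ih (fun a ha => h a (by simp [ha]))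
    obtain ⟨q', r2', h1', h2', h3'⟩ := h a (by simp)
    rcases List.append_eq_append_iff.1 (h1.symm.trans h1') with ⟨t, rfl, rfl⟩ | ⟨t, rfl, rfl⟩
    · refine ⟨_, _, h1', ?_, h3'⟩
      intro c hc
      rcases List.mem_cons.1 hc with rfl | hc
      · exact h2'
      · have := h2 c hc
        simp at this ⊢; omega
    · refine ⟨_, _, h1, ?_, h3⟩
      intro c hc
      rcases List.mem_cons.1 hc with rfl | hc
      · simp at h2' ⊢; omega
      · exact h2 c hc

theorem count_two {P q : List ℕ} {a} (h : a ∈ P) (h' : a ∈ q) : 2 ≤ (P ++ q).count a := by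
  have := List.count_pos_iff.2 h
  have := List.count_pos_iff.2 h'
  simp; omega

theorem dge_all {k P q r2} (h : ∀ b ∈ q, b ∉ P → dge k (P ++ q) r2 b) :
    ∀ b ∈ q, dge k (P ++ q) r2 b := by
  intro b hb
  by_cases hP : b ∈ P
  · exact dge_of_count (count_two hP hb)
  · exact h b hb hP

theorem dge_close (k : ℕ) : ∀ (P r W : List ℕ), r.length < k → (∀ a ∈ W, dge k P r a) →
    ∃ q r2, r = q ++ r2 ∧ ∀ a ∈ W ++ q, 2 ≤ (P ++ q).count a := by
  induction k with
  | zero => intro P r W h; simp at h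
  | succ k ih =>
    intro P r W hr h
    obtain ⟨q, r2, rfl, h2, h3⟩ := dge_split W h
    by_cases hq : q = []
    · subst hq
      exact ⟨[], r2, rfl, by simpa using h2⟩
    · have hl : 0 < q.length := List.length_pos_iff.2 hq
      obtain ⟨q', r3, rfl, h4⟩ := ih (P ++ q) r2 q (by simp at hr; omega) (dge_all h3)
      refine ⟨q ++ q', r3, by simp, ?_⟩
      intro a ha
      rcases List.mem_append.1 ha with ha | ha
      · have := h2 a ha
        simp at this ⊢; omega
      · simpa using h4 a ha

/-! ### Consequences of the identities of `K` -/

variable {θ : List ℕ → List ℕ → Prop}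

theorem FIC.ins1 (h : FIC θ) {p : List ℕ} {a : ℕ} (ha : 2 ≤ p.count a) (r : List ℕ) :
    θ (p ++ r) (p ++ a :: r) := by
  have h1 : a ∈ p := List.count_pos_iff.1 (by omega)
  obtain ⟨p1, p2, rfl, hp1⟩ := List.append_of_mem h1 |>.elim fun s hs => hs.elim fun t ht =>
    (⟨s, t, ht, trivial⟩ : ∃ s t, p = s ++ a :: t ∧ True)
  by_cases hp2 : a ∈ p2
  · obtain ⟨s, t, rfl⟩ := List.append_of_mem hp2
    have e1 := h.mul p1 (t ++ r) (h.k1 [a] s)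
    have e2 := h.mul (p1 ++ a :: s) r (h.k3 [a] t)
    have e3 := h.mul p1 (t ++ a :: r) (h.k1 [a] s)
    simp at e1 e2 e3 ⊢
    exact h.trans e1 (h.trans e2 (h.symm e3))
  · have : a ∈ p1 := by
      simp [List.count_eq_zero_of_not_mem hp2] at ha
      exact ha
    obtain ⟨s, t, rfl⟩ := List.append_of_mem this
    have e1 := h.mul s (p2 ++ r) (h.k1 [a] t)
    have e2 := h.mul (s ++ a :: t) r (h.k3 [a] p2)
    have e3 := h.mul s (p2 ++ a :: r) (h.k1 [a] t)
    simp at e1 e2 e3 ⊢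
    exact h.trans e1 (h.trans e2 (h.symm e3))

theorem FIC.ins (h : FIC θ) {p w : List ℕ} (hw : ∀ a ∈ w, 2 ≤ p.count a) (r : List ℕ) :
    θ (p ++ r) (p ++ (w ++ r)) := by
  induction w generalizing p with
  | nil => exact h.refl _
  | cons a w ih =>
    refine h.trans (h.ins1 (hw a (by simp)) r) ?_
    have := ih (p := p ++ [a]) (fun b hb => by
      have := hw b (by simp [hb])
      simp; omega)
    simpa using this

theorem FIC.swap22 (h : FIC θ) {p : List ℕ} {a b : ℕ} (ha : a ∈ p) (hb : b ∈ p) (r : List ℕ) :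
    θ (p ++ a :: b :: r) (p ++ b :: a :: r) := by
  have ca := List.count_pos_iff.2 ha
  have cb := List.count_pos_iff.2 hb
  have key : ∀ a b : ℕ, 0 < p.count a → 0 < p.count b →
      θ (p ++ a :: b :: r) (p ++ a :: a :: b :: b :: r) := by
    intro a b ca cb
    have e1 := h.ins1 (p := p ++ [a]) (a := a)
      (count_two (List.count_pos_iff.1 ca) (by simp)) (b :: r)
    have e2 := h.ins1 (p := p ++ [a, a, b]) (a := b) (by
      have : 0 < [a, a, b].count b := List.count_pos_iff.2 (by simp)
      rw [List.count_append]; omega) r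
    simp at e1 e2
    exact h.trans e1 e2
  have := h.mul p r (h.k2 [a] [b])
  simp at this
  exact h.trans (key a b ca cb) (h.trans this (h.symm (key b a cb ca)))

theorem FIC.swapsq (h : FIC θ) {p : List ℕ} {x y : ℕ} (hy : y ∈ p) (r : List ℕ) :
    θ (p ++ y :: x :: x :: r) (p ++ x :: x :: y :: r) := by
  have cy := List.count_pos_iff.2 hy
  have e1 := h.ins1 (p := p ++ [y]) (a := y) (count_two hy (by simp)) (x :: x :: r)
  have e2 := h.mul p r (h.k2 [y] [x])
  have e3 := h.ins1 (p := p ++ [x, x, y]) (a := y) (count_two hy (by simp)) r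
  simp at e1 e2 e3
  exact h.trans e1 (h.trans e2 (h.symm e3))

theorem FIC.sq (h : FIC θ) {p B : List ℕ} (hB : ∀ a ∈ B, 2 ≤ (p ++ B).count a) {x : ℕ}
    (hx : x ∈ B) (r : List ℕ) : θ (p ++ (B ++ r)) (p ++ x :: x :: (B ++ r)) := by
  have e1 := h.ins (p := p ++ B) (w := B ++ [x, x]) (by
    intro a ha
    apply hB
    simp at ha
    rcases ha with ha | rfl
    · exact ha
    · exact hx) r
  have e2 := h.mul p r (h.k2 B [x])
  have e3 := h.ins (p := p ++ x :: x :: B) (w := B) (by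
    intro a ha
    have := hB a ha
    simp [List.count_cons] at this ⊢; omega) r
  simp at e1 e2 e3
  exact h.trans e1 (h.trans e2 (h.symm e3))

theorem FIC.perm2 (h : FIC θ) {p σ τ : List ℕ} (hp : σ.Perm τ) (hσ : ∀ a ∈ σ, a ∈ p)
    (r : List ℕ) : θ (p ++ (σ ++ r)) (p ++ (τ ++ r)) := by
  induction hp generalizing p with
  | nil => exact h.refl _
  | cons x _ ih =>
    have := ih (p := p ++ [x]) (fun a ha => by simp [hσ a (by simp [ha])])
    simpa using this
  | swap x y l =>
    have := h.swap22 (p := p) (a := y) (b := x) (hσ _ (by simp)) (hσ _ (by simp)) (l ++ r)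
    simpa using this
  | trans h1 h2 ih1 ih2 =>
    exact h.trans (ih1 hσ) (ih2 (fun a ha => hσ a (h1.mem_iff.2 ha)))

end KHFB
namespace KHFB

/-! ### Canonical words -/

variable {θ : List ℕ → List ℕ → Prop}

def zif (k m : ℕ) (Z : List ℕ) : List ℕ := if k = m then Z else []

def B2 (f : ℕ → List ℕ) (Z : List ℕ) (m : ℕ) : ℕ → List ℕ
  | 0 => []
  | k + 1 => f k ++ (f (k + 1) ++ (zif (k + 1) m Z ++ B2 f Z m k))

def idl : ℕ → List ℕ := fun i => [i]

theorem B2_congr {f g : ℕ → List ℕ} {Z m k} (h : ∀ i ≤ k, f i = g i) :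
    B2 f Z m k = B2 g Z m k := by
  induction k with
  | zero => rfl
  | succ k ih =>
    simp only [B2]
    rw [ih (fun i hi => h i (by omega)), h k (by omega), h (k + 1) (by omega)]

theorem B2_flatMap {f : ℕ → List ℕ} {Z m k} (g : ℕ → List ℕ) :
    (B2 f Z m k).flatMap g = B2 (fun i => (f i).flatMap g) (Z.flatMap g) m k := by
  induction k with
  | zero => rfl
  | succ k ih =>
    simp only [B2, zif]
    split <;> simp [ih]

theorem B2_zero {f : ℕ → List ℕ} {Z Z' k} : B2 f Z 0 k = B2 f Z' 0 k := by
  induction k with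
  | zero => rfl
  | succ k ih => simp [B2, zif, ih]

theorem back2 (Z : List ℕ) (m : ℕ) : ∀ (k : ℕ) (P r W : List ℕ), (∀ a ∈ W, dge k P r a) →
    (m ≤ k → ∀ a ∈ Z, dge m P r a) → ∃ (f : ℕ → List ℕ) (r' : List ℕ), f k = W ∧
      ∀ θ, FIC θ → ∀ P', (∀ c, P.count c ≤ P'.count c) →
        θ (P' ++ r) (P' ++ (B2 f Z m k ++ r')) := by
  intro k
  induction k with
  | zero => intro P r W _ _; exact ⟨fun _ => W, r, rfl, fun θ h P' _ => h.refl _⟩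
  | succ k ih =>
    intro P r W hW hZ
    obtain ⟨q, r2, rfl, h2, h3⟩ := dge_split (k := k) (P := P) (r := r)
      (W ++ zif (k + 1) m Z) (by
        intro a ha
        rcases List.mem_append.1 ha with hb | hb
        · exact hW a hb
        · unfold zif at hb
          split at hb
          · rename_i hm
            subst hm
            exact hZ le_rfl a hb
          · simp at hb)
    obtain ⟨f, r', hf, hθ⟩ := ih (P ++ q) r2 q (dge_all h3)
      (fun hm a ha => dge_shift (hZ (by omega) a ha))
    refine ⟨Function.update f (k + 1) W, r', by simp, fun θ h P' hP' => ?_⟩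
    have e1 := h.ins (p := P' ++ q) (w := W ++ zif (k + 1) m Z) (by
      intro a ha
      have := h2 a ha
      have := hP' a
      rw [List.count_append] at *
      omega) r2
    have e2 := hθ θ h (P' ++ q ++ (W ++ zif (k + 1) m Z)) (by
      intro c
      have := hP' c
      simp only [List.count_append]
      omega)
    have e3 : B2 (Function.update f (k + 1) W) Z m k = B2 f Z m k := by
      apply B2_congr
      intro i hi
      rw [Function.update_of_ne (by omega)]
    simp only [B2, e3]
    rw [Function.update_of_ne (by omega), hf]
    simp only [Function.update_self, List.append_assoc] at *
    exact h.trans e1 e2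

/-- canonical word: chain letters `0..k`, additional letter `k+1`. -/
def cw (m k : ℕ) : List ℕ := B2 idl [k + 1] m k

def tau (k : ℕ) (W Z : List ℕ) (y : ℕ) : ℕ → List ℕ := fun i =>
  if i = k then W else if i = k + 1 then Z else [y]

theorem der (h : FIC θ) {A A' : List ℕ} {k m : ℕ} (hA : ∀ a ∈ A, k ≤ a) (hp : A.Perm A')
    (he : θ (A ++ cw m k) (A' ++ cw m k)) (W Z : List ℕ) (y : ℕ) (p r : List ℕ)
    (hW : ∀ a ∈ W, dge k (p ++ A.flatMap (tau k W Z y)) r a)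
    (hZ : m ≤ k → ∀ a ∈ Z, dge m (p ++ A.flatMap (tau k W Z y)) r a) :
    θ (p ++ (A.flatMap (tau k W Z y) ++ r)) (p ++ (A'.flatMap (tau k W Z y) ++ r)) := by
  obtain ⟨f, r', hf, hθ⟩ := back2 Z m k _ r W hW hZ
  let σ : ℕ → List ℕ := fun i => if i < k then f i else tau k W Z y i
  have hσ : ∀ A : List ℕ, (∀ a ∈ A, k ≤ a) → A.flatMap σ = A.flatMap (tau k W Z y) := by
    intro A hA
    apply List.flatMap_congr
    intro a ha
    have := hA a ha
    simp only [σ, if_neg (by omega : ¬ a < k)]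
  have hB : (cw m k).flatMap σ = B2 f Z m k := by
    unfold cw
    rw [B2_flatMap]
    have : [k + 1].flatMap σ = Z := by simp [σ, tau]
    rw [this]
    apply B2_congr
    intro i hi
    rcases Nat.lt_or_ge i k with hik | hik
    · simp [σ, idl, hik]
    · have : i = k := by omega
      subst this
      simp [σ, idl, tau, hf]
  have e := h.subst σ he
  rw [List.flatMap_append, List.flatMap_append, hB, hσ A hA,
    hσ A' (fun a ha => hA a (hp.mem_iff.2 ha))] at e
  have e1 := h.mul p r' e
  have hpe : ((p ++ A.flatMap (tau k W Z y))).Perm (p ++ A'.flatMap (tau k W Z y)) :=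
    List.Perm.append_left _ (List.Perm.flatMap_right _ hp)
  have e2 := hθ θ h (p ++ A.flatMap (tau k W Z y)) (fun c => le_rfl)
  have e3 := hθ θ h (p ++ A'.flatMap (tau k W Z y)) (fun c => (hpe.count_eq c).le)
  simp only [List.append_assoc] at *
  exact h.trans e2 (h.trans e1 (h.symm e3))

/-- prefix words. -/
def eP : ℕ → ℕ → List ℕ
  | 0, k => [k, k + 2, k + 2]
  | 1, k => [k + 2, k, k + 2]
  | _ + 2, k => [k + 2, k + 2, k]

def eW (a k : ℕ) : List ℕ := eP a k ++ cw 0 k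

theorem eP_ge {a k b : ℕ} (h : b ∈ eP a k) : k ≤ b := by
  match a with
  | 0 => simp [eP] at h; omega
  | 1 => simp [eP] at h; omega
  | a + 2 => simp [eP] at h; omega

theorem eP_perm (a a' k : ℕ) : (eP a k).Perm (eP a' k) := by
  have : ∀ a, (eP a k).Perm [k, k + 2, k + 2] := by
    intro a
    match a with
    | 0 => simp [eP]
    | 1 => exact List.Perm.swap _ _ _
    | a + 2 =>
      simp only [eP]
      exact (List.Perm.cons _ (List.Perm.swap _ _ _)).trans (List.Perm.swap _ _ _)
  exact (this a).trans (this a').symm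

def Eta (θ : List ℕ → List ℕ → Prop) (k : ℕ) : Prop := θ (eW 2 k) (eW 1 k)
def Beta (θ : List ℕ → List ℕ → Prop) (k : ℕ) : Prop := θ (eW 1 k) (eW 0 k)
def Alpha (θ : List ℕ → List ℕ → Prop) (k : ℕ) : Prop :=
  θ ([k, k + 1] ++ cw k k) ([k + 1, k] ++ cw k k)
def Delta (θ : List ℕ → List ℕ → Prop) (k m : ℕ) : Prop :=
  θ ([k + 2, k + 1, k, k + 2] ++ cw m k) ([k + 2, k + 1, k + 2, k] ++ cw m k)

theorem der_eta (h : FIC θ) {k} (he : Eta θ k) {p X r : List ℕ} {y : ℕ}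
    (hX : ∀ a ∈ X, dge k (p ++ y :: (X ++ [y])) r a) :
    θ (p ++ y :: (X ++ y :: r)) (p ++ y :: y :: (X ++ r)) := by
  have := der h (A := eP 1 k) (A' := eP 2 k) (m := 0) (fun a ha => eP_ge ha) (eP_perm 1 2 k)
    (h.symm he) X [] y p r (by simpa [eP, tau] using hX) (fun _ a _ => trivial)
  simpa [eP, tau] using this

theorem der_beta (h : FIC θ) {k} (he : Beta θ k) {p X r : List ℕ} {y : ℕ}
    (hX : ∀ a ∈ X, dge k (p ++ y :: (X ++ [y])) r a) :
    θ (p ++ y :: (X ++ y :: r)) (p ++ (X ++ y :: y :: r)) := by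
  have := der h (A := eP 1 k) (A' := eP 0 k) (m := 0) (fun a ha => eP_ge ha) (eP_perm 1 0 k)
    he X [] y p r (by simpa [eP, tau] using hX) (fun _ a _ => trivial)
  simpa [eP, tau] using this

theorem der_alpha (h : FIC θ) {k} (he : Alpha θ k) {p r : List ℕ} {x y : ℕ}
    (hx : dge k (p ++ [x, y]) r x) (hy : dge k (p ++ [x, y]) r y) :
    θ (p ++ x :: y :: r) (p ++ y :: x :: r) := by
  have := der h (A := [k, k + 1]) (A' := [k + 1, k]) (m := k) (by simp) (List.Perm.swap _ _ _)
    he [x] [y] y p r (by simpa [tau] using hx) (by simpa [tau] using hy)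
  simpa [tau] using this

theorem der_delta (h : FIC θ) {k m} (he : Delta θ k m) {p Q r : List ℕ} {x y : ℕ}
    (hx : dge k (p ++ y :: (Q ++ [x, y])) r x)
    (hQ : ∀ a ∈ Q, dge m (p ++ y :: (Q ++ [x, y])) r a) :
    θ (p ++ y :: (Q ++ x :: y :: r)) (p ++ y :: (Q ++ y :: x :: r)) := by
  have := der h (A := [k + 2, k + 1, k, k + 2]) (A' := [k + 2, k + 1, k + 2, k]) (m := m)
    (by simp) (by
      refine List.Perm.cons _ (List.Perm.cons _ ?_)
      exact List.Perm.swap _ _ _)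
    he [x] Q y p r (by simpa [tau] using hx) (by simpa [tau] using fun _ => hQ)
  simpa [tau] using this

end KHFB
namespace KHFB

/-! ### Chains -/

variable {θ : List ℕ → List ℕ → Prop}

/-- normalized words: every letter occurs at most twice -/
def Nrm (u : List ℕ) : Prop := ∀ c, u.count c ≤ 2

def Chn (f : ℕ → ℕ) (Z : List ℕ) (m : ℕ) : ℕ → List ℕ → Prop
  | 0, L => L = []
  | k + 1, L => ∃ σ L', L = f k :: (σ ++ L') ∧ σ.Perm (f (k + 1) :: zif (k + 1) m Z) ∧
      Chn f Z m k L'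

theorem Chn.congr {f g : ℕ → ℕ} {Z m k L} (h : ∀ i ≤ k, f i = g i) (hc : Chn f Z m k L) :
    Chn g Z m k L := by
  induction k generalizing L with
  | zero => exact hc
  | succ k ih =>
    obtain ⟨σ, L', rfl, h2, h3⟩ := hc
    refine ⟨σ, L', by rw [h k (by omega)], by rwa [← h (k + 1) (by omega)],
      ih (fun i hi => h i (by omega)) h3⟩

theorem Chn.map {f : ℕ → ℕ} {Z m k L} (h : ℕ → ℕ) (hc : Chn f Z m k L) :
    Chn (fun i => h (f i)) (Z.map h) m k (L.map h) := by
  induction k generalizing L with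
  | zero => simp [Chn] at hc ⊢; exact hc
  | succ k ih =>
    obtain ⟨σ, L', rfl, h2, h3⟩ := hc
    refine ⟨σ.map h, L'.map h, by simp, ?_, ih h3⟩
    have := h2.map h
    unfold zif at this ⊢
    split <;> simp_all

theorem Chn.eq {f : ℕ → ℕ} {Z Z' k L} (hc : Chn f Z 0 k L) :
    L = B2 (fun i => [f i]) Z' 0 k := by
  induction k generalizing L with
  | zero => exact hc
  | succ k ih =>
    obtain ⟨σ, L', rfl, h2, h3⟩ := hc
    simp [zif] at h2
    simp [B2, zif, ← ih h3, h2]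

theorem Chn.rel (h : FIC θ) {f : ℕ → ℕ} {Z m k L} (hc : Chn f Z m k L) {p : List ℕ}
    (hk : f k ∈ p) (hZ : ∀ z ∈ Z, z ∈ p) : θ (p ++ L) (p ++ B2 (fun i => [f i]) Z m k) := by
  induction k generalizing L p with
  | zero => simp [Chn] at hc; subst hc; exact h.refl _
  | succ k ih =>
    obtain ⟨σ, L', rfl, h2, h3⟩ := hc
    have hz : ∀ a ∈ zif (k + 1) m Z, a ∈ p := by
      intro a ha
      unfold zif at ha
      split at ha
      · exact hZ a ha
      · simp at ha
    have e1 := h.perm2 (p := p ++ [f k]) h2 (by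
      intro a ha
      have := h2.mem_iff.1 ha
      rcases List.mem_cons.1 this with rfl | h'
      · simp [hk]
      · simp [hz a h']) L'
    have e2 := ih h3 (p := p ++ [f k] ++ (f (k + 1) :: zif (k + 1) m Z)) (by simp)
      (fun z hz => by simp [hZ z hz])
    simp [B2] at e1 e2 ⊢
    exact h.trans e1 e2

theorem first_split {q : List ℕ} {p : ℕ → Prop} (h : ∃ a ∈ q, p a) :
    ∃ r1 b q2, q = r1 ++ b :: q2 ∧ p b ∧ ∀ a ∈ r1, ¬ p a := by
  induction q with
  | nil => simp at h
  | cons c q ih =>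
    by_cases hc : p c
    · exact ⟨[], c, q, rfl, hc, by simp⟩
    · obtain ⟨a, ha, hp⟩ := h
      have : a ∈ q := by
        rcases List.mem_cons.1 ha with rfl | h'
        · exact absurd hp hc
        · exact h'
      obtain ⟨r1, b, q2, rfl, hb, hr⟩ := ih ⟨a, this, hp⟩
      refine ⟨c :: r1, b, q2, rfl, hb, ?_⟩
      intro a ha
      rcases List.mem_cons.1 ha with rfl | h'
      · exact hc
      · exact hr a h'

def chS (f : ℕ → ℕ) (Z : List ℕ) (k : ℕ) : List ℕ := (List.range (k + 1)).map f ++ Z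

theorem mem_chS {f : ℕ → ℕ} {Z k a} : a ∈ chS f Z k ↔ (∃ i ≤ k, f i = a) ∨ a ∈ Z := by
  simp [chS]

theorem count_pos_of {l : List ℕ} {a : ℕ} (h : a ∈ l) : 0 < l.count a := List.count_pos_iff.2 h

theorem count_zero_of {l : List ℕ} {a : ℕ} (h : a ∉ l) : l.count a = 0 :=
  List.count_eq_zero_of_not_mem h

theorem chainLem (Z : List ℕ) (hZn : Z.Nodup) (m : ℕ) : ∀ (k : ℕ) (P r : List ℕ) (x : ℕ),
    Nrm (P ++ r) → P.count x = 1 → dge k P r x → ¬ dge (k + 1) P r x → x ∉ Z →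
    (∀ z ∈ Z, z ∈ P ∧ (m ≤ k → P.count z = 1 ∧ dge m P r z ∧ ¬ dge (m + 1) P r z) ∧
      (k < m → z ∉ r)) →
    ∃ f : ℕ → ℕ, f k = x ∧ (∀ i < k, f i ∉ P) ∧ (∀ i ≤ k, ∀ i' ≤ k, f i = f i' → i = i') ∧
      Chn f Z m k (r.filter (fun a => decide (a ∈ chS f Z k))) := by
  intro k
  induction k with
  | zero =>
    intro P r x hN hx _ hd hxZ hZ
    refine ⟨fun _ => x, rfl, by simp, by intro i hi i' hi'; omega, ?_⟩
    have key : ∀ w ∈ P, ¬ dge 1 P r w → w ∉ r := by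
      intro w hw hd hr
      exact hd ⟨r, [], by simp, count_two hw hr, fun _ _ _ => trivial⟩
    simp only [Chn, List.filter_eq_nil_iff, decide_eq_true_eq]
    intro a ha hS
    rcases mem_chS.1 hS with ⟨i, _, rfl⟩ | hz
    · exact key x (List.count_pos_iff.1 (by omega)) hd ha
    · obtain ⟨h1, h2, h3⟩ := hZ a hz
      rcases Nat.eq_zero_or_pos m with rfl | hm
      · exact key a h1 (h2 le_rfl).2.2 ha
      · exact h3 hm ha
  | succ k ih =>
    intro P r x hN hx hdx hndx hxZ hZ
    have hxP : x ∈ P := List.count_pos_iff.1 (by omega)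
    -- properties of the letters of level k+1
    have hw : ∀ w ∈ x :: zif (k + 1) m Z, P.count w = 1 ∧ dge (k + 1) P r w ∧
        ¬ dge (k + 2) P r w := by
      intro w hw
      rcases List.mem_cons.1 hw with rfl | hw'
      · exact ⟨hx, hdx, hndx⟩
      · unfold zif at hw'
        split at hw'
        · rename_i hm
          subst hm
          exact (hZ w hw').2.1 le_rfl
        · simp at hw'
    obtain ⟨q, r3, rfl, h2, h3⟩ := dge_split (k := k) (P := P) (r := r) _
      (fun a ha => (hw a ha).2.1)
    have hex : ∃ b ∈ q, b ∉ P ∧ ¬ dge (k + 1) (P ++ q) r3 b := by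
      by_contra hcon
      push Not at hcon
      exact hndx ⟨q, r3, rfl, h2 x (by simp), hcon⟩
    obtain ⟨r1, b, q2, rfl, ⟨hbP, hbd⟩, hr1⟩ := first_split hex
    have hwr1 : ∀ w ∈ x :: zif (k + 1) m Z, w ∉ r1 := by
      intro w hww hwr
      obtain ⟨c1, c2, c3⟩ := hw w hww
      apply c3
      refine ⟨r1, b :: q2 ++ r3, by simp, count_two (List.count_pos_iff.1 (by omega)) hwr, ?_⟩
      intro c hc hcP
      have := hr1 c hc
      push Not at this
      have h4 := this hcP
      apply dge_unshift
      · intro c' hc' hcP'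
        have := h3 c' (by simp at hc' ⊢; tauto) (by simp at hcP'; tauto)
        simpa using this
      · simpa using h4
    have hcb : (P ++ (r1 ++ b :: q2)).count b = 1 := by
      have : ¬ 2 ≤ (P ++ (r1 ++ b :: q2)).count b := fun hh => hbd (dge_of_count hh)
      have := count_pos_of (l := P ++ (r1 ++ b :: q2)) (a := b) (by simp)
      omega
    have hzq : m ≤ k → ∀ z ∈ Z, z ∉ r1 ++ b :: q2 := by
      intro hm z hz hzq
      obtain ⟨c0, c1, _⟩ := hZ z hz
      obtain ⟨c1, c2, c3⟩ := c1 (by omega)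
      apply c3
      exact ⟨_, _, rfl, count_two c0 hzq, fun c hc hcP => dge_le hm (h3 c hc hcP)⟩
    have hN' : ∀ w, 2 ≤ (P ++ (r1 ++ b :: q2)).count w → w ∉ r3 := by
      intro w hw hwr
      have a1 := hN w
      have a2 := count_pos_of hwr
      rw [← List.append_assoc, List.count_append] at a1
      omega
    obtain ⟨f, hfk, hfP, hfi, hfc⟩ := ih (P ++ (r1 ++ b :: q2)) r3 b (by simpa using hN) hcb
      (h3 b (by simp) hbP) hbd (fun hh => hbP (hZ b hh).1) (by
        intro z hz
        obtain ⟨c0, c1, c2⟩ := hZ z hz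
        refine ⟨by simp [c0], ?_, ?_⟩
        · intro hm
          obtain ⟨d1, d2, d3⟩ := c1 (by omega)
          refine ⟨?_, dge_shift d2, ?_⟩
          · rw [List.count_append, count_zero_of (hzq hm z hz), d1]
          · intro hh
            exact d3 (dge_unshift (fun c hc hcP => dge_le hm (h3 c hc hcP)) hh)
        · intro hm
          rcases Nat.lt_or_ge (k + 1) m with hm' | hm'
          · have := c2 hm'
            simp at this ⊢; tauto
          · apply hN'
            apply h2
            simp [zif, show k + 1 = m by omega, hz])
    have hfx : ∀ i ≤ k, f i ≠ x := by
      intro i hi hh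
      rcases Nat.lt_or_ge i k with hik | hik
      · exact hfP i hik (by simp [hh, hxP])
      · have : i = k := by omega
        subst this
        rw [hfk] at hh
        exact hbP (hh ▸ hxP)
    have hup : ∀ i ≤ k, Function.update f (k + 1) x i = f i := by
      intro i hi
      rw [Function.update_of_ne (by omega)]
    have hS : ∀ a, a ∈ chS (Function.update f (k + 1) x) Z (k + 1) ↔ a = x ∨ a ∈ chS f Z k := by
      intro a
      rw [mem_chS, mem_chS]
      constructor
      · rintro (⟨i, hi, rfl⟩ | hz)
        · rcases Nat.lt_or_ge i (k + 1) with hik | hik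
          · rw [hup i (by omega)]
            exact Or.inr (Or.inl ⟨i, by omega, rfl⟩)
          · have : i = k + 1 := by omega
            subst this
            simp
        · exact Or.inr (Or.inr hz)
      · rintro (rfl | ⟨i, hi, rfl⟩ | hz)
        · exact Or.inl ⟨k + 1, le_rfl, by simp⟩
        · exact Or.inl ⟨i, by omega, hup i hi⟩
        · exact Or.inr hz
    have hbr : b ∉ r1 ∧ b ∉ q2 := by
      simp at hcb
      constructor
      · intro hh
        have := count_pos_of hh
        omega
      · intro hh
        have := count_pos_of hh
        omega
    -- letters of the block
    have hblk : ∀ a, a ∈ r1 ∨ a ∈ q2 → a ∈ chS (Function.update f (k + 1) x) Z (k + 1) →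
        a ∈ x :: zif (k + 1) m Z := by
      intro a ha haS
      rcases (hS a).1 haS with rfl | haS
      · simp
      · rcases mem_chS.1 haS with ⟨i, hi, rfl⟩ | hz
        · exfalso
          rcases Nat.lt_or_ge i k with hik | hik
          · exact hfP i hik (by simp; tauto)
          · have : i = k := by omega
            subst this
            rw [hfk] at ha
            tauto
        · rcases Nat.lt_trichotomy (k + 1) m with hm | hm | hm
          · exact absurd (by simp; tauto) ((hZ a hz).2.2 hm)
          · simp [zif, hm, hz]
          · exact absurd (by simp; tauto) (hzq (by omega) a hz)
    refine ⟨Function.update f (k + 1) x, by simp, ?_, ?_, ?_⟩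
    · intro i hi
      rw [hup i (by omega)]
      rcases Nat.lt_or_ge i k with hik | hik
      · have := hfP i hik
        simp at this ⊢; tauto
      · have : i = k := by omega
        subst this
        rwa [hfk]
    · intro i hi i' hi' he
      rcases Nat.lt_or_ge i (k + 1) with hik | hik <;>
        rcases Nat.lt_or_ge i' (k + 1) with hik' | hik'
      · rw [hup i (by omega), hup i' (by omega)] at he
        exact hfi i (by omega) i' (by omega) he
      · have : i' = k + 1 := by omega
        subst this
        rw [hup i (by omega), Function.update_self] at he
        exact absurd he (hfx i (by omega))
      · have : i = k + 1 := by omega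
        subst this
        rw [hup i' (by omega), Function.update_self] at he
        exact absurd he.symm (hfx i' (by omega))
      · omega
    · refine ⟨q2.filter (fun a => decide (a ∈ chS (Function.update f (k + 1) x) Z (k + 1))),
        r3.filter (fun a => decide (a ∈ chS f Z k)), ?_, ?_, ?_⟩
      · rw [hup k le_rfl, hfk, List.filter_append, List.filter_append, List.filter_cons]
        have e1 : r1.filter (fun a => decide (a ∈ chS (Function.update f (k + 1) x) Z (k + 1)))
            = [] := by
          rw [List.filter_eq_nil_iff]
          intro a ha haS
          exact hwr1 a (hblk a (Or.inl ha) (by simpa using haS)) ha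
        have e2 : b ∈ chS (Function.update f (k + 1) x) Z (k + 1) :=
          (hS b).2 (Or.inr (mem_chS.2 (Or.inl ⟨k, le_rfl, hfk⟩)))
        have e3 : r3.filter (fun a => decide (a ∈ chS (Function.update f (k + 1) x) Z (k + 1)))
            = r3.filter (fun a => decide (a ∈ chS f Z k)) := by
          apply List.filter_congr
          intro a ha
          have : a ≠ x := by
            rintro rfl
            exact hN' a (h2 a (by simp)) ha
          simp [hS, this]
        rw [e1, e3]
        simp [e2]
      · have hq2 : ∀ w ∈ x :: zif (k + 1) m Z, w ∈ q2 := by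
          intro w hww
          have c1 := (hw w hww).1
          have c2 := h2 w hww
          have c3 := hwr1 w hww
          have c4 : w ≠ b := by
            rintro rfl
            exact hbP (List.count_pos_iff.1 (by omega))
          rw [List.count_append, c1] at c2
          have : w ∈ r1 ++ b :: q2 := List.count_pos_iff.1 (by omega)
          simp at this; tauto
        rw [Function.update_self]
        rw [List.perm_ext_iff_of_nodup]
        · intro a
          simp only [List.mem_filter, decide_eq_true_eq]
          constructor
          · rintro ⟨h5, h6⟩
            exact hblk a (Or.inr h5) h6
          · intro h5
            refine ⟨hq2 a h5, ?_⟩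
            rcases List.mem_cons.1 h5 with rfl | h6
            · exact (hS _).2 (Or.inl rfl)
            · refine (hS _).2 (Or.inr (mem_chS.2 (Or.inr ?_)))
              unfold zif at h6
              split at h6
              · exact h6
              · simp at h6
        · rw [List.nodup_iff_count_le_one]
          intro a
          by_cases ha : a ∈ q2.filter
              (fun a => decide (a ∈ chS (Function.update f (k + 1) x) Z (k + 1)))
          · have ha' := List.mem_filter.1 ha
            have c1 := (hw a (hblk a (Or.inr ha'.1) (by simpa using ha'.2))).1
            have c2 := hN a
            have c3 := List.filter_sublist.count_le a (l₁ := q2.filter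
              (fun a => decide (a ∈ chS (Function.update f (k + 1) x) Z (k + 1)))) (l₂ := q2)
            simp only [List.count_append, List.count_cons] at c2
            omega
          · rw [count_zero_of ha]; omega
        · rw [List.nodup_cons]
          unfold zif
          split
          · exact ⟨hxZ, hZn⟩
          · simp
      · exact hfc.congr (fun i hi => (hup i hi).symm)

end KHFB
namespace KHFB

/-! ### Agreement of first occurrences -/

variable {θ : List ℕ → List ℕ → Prop}

def HP (θ : List ℕ → List ℕ → Prop) : Prop := ∀ u v, θ u v → Nrm u → Nrm v → u.Perm v

def Agr (θ : List ℕ → List ℕ → Prop) (j : ℕ) : Prop :=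
  ∀ u v P x R, θ u v → Nrm u → Nrm v → u = P ++ x :: R → x ∉ P →
    ¬ dge (j + 1) (P ++ [x]) R x → ∃ P' R', v = P' ++ x :: R' ∧ P'.Perm P

theorem nb {Z : List ℕ} {m : ℕ} : ∀ (j : ℕ) (S t : List ℕ),
    (∀ i ≤ j, i ∉ S ∧ i ∉ t ∧ i ∉ Z) →
    ¬ dge (j + 1) (S ++ [j]) (t ++ B2 idl Z m j) j := by
  intro j
  induction j with
  | zero =>
    rintro S t h ⟨q, r2, h1, h2, -⟩
    simp [B2] at h1
    have h3 := h 0 le_rfl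
    subst h1
    have : 0 ∉ q := fun hh => h3.2.1 (by simp [hh])
    simp [count_zero_of h3.1, count_zero_of this] at h2
  | succ j ih =>
    rintro S t h ⟨q, r2, h1, h2, h3⟩
    simp only [B2, idl] at h1
    obtain ⟨a1, a2, a3⟩ := h (j + 1) le_rfl
    obtain ⟨b1, b2, b3⟩ := h j (by omega)
    have hz : ∀ i ≤ j, i ∉ zif (j + 1) m Z := by
      intro i hi
      unfold zif
      split
      · exact (h i (by omega)).2.2
      · simp
    have hjq : j + 1 ∈ q := by
      rw [List.count_append] at h2
      have : (S ++ [j + 1]).count (j + 1) = 1 := by simp [count_zero_of a1]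
      exact List.count_pos_iff.1 (by omega)
    rcases List.append_eq_append_iff.1 h1 with ⟨t', rfl, h5⟩ | ⟨t', rfl, -⟩
    · rcases t' with _ | ⟨c, q'⟩
      · simp at hjq; exact a2 hjq
      · simp only [List.cons_append, List.nil_append, List.cons.injEq] at h5
        obtain ⟨rfl, h5⟩ := h5
        have hj := h3 j (by simp) (by simp [b1])
        refine ih (S ++ (j + 1) :: t) ((j + 1) :: zif (j + 1) m Z) ?_ ?_
        · intro i hi
          have := h i (by omega)
          have h4 := hz i hi
          refine ⟨?_, ?_, this.2.2⟩
          · simp; refine ⟨this.1, by omega, this.2.1⟩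
          · simp; exact ⟨by omega, h4⟩
        · have h5' : (j + 1) :: zif (j + 1) m Z ++ B2 idl Z m j = q' ++ r2 := by
            simpa using h5
          change dge (j + 1) _ _ _
          rw [h5']
          apply dge_unshift
          · intro c hc hcP
            have := h3 c (by simp [hc]) (by simp at hcP ⊢; tauto)
            simpa using dge_mono this
          · simpa using hj
    · exact a2 (by simp [hjq])

theorem cLem (hP : HP θ) {Z : List ℕ} {m : ℕ} : ∀ (k : ℕ) (s v : List ℕ),
    (∀ i < k, Agr θ i) → (∀ i < k, i ∉ s ∧ i ∉ Z) → θ (s ++ B2 idl Z m k) v →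
    Nrm (s ++ B2 idl Z m k) → Nrm v →
    ∃ s' L, v = s' ++ L ∧ s'.Perm s ∧ Chn (fun i => i) Z m k L := by
  intro k
  induction k with
  | zero =>
    intro s v _ _ h h1 h2
    exact ⟨v, [], by simp, by simpa [B2] using (hP _ _ h h1 h2).symm, rfl⟩
  | succ k ih =>
    intro s v hA hi h h1 h2
    have hz : ∀ i < k + 1, i ∉ zif (k + 1) m Z := by
      intro i hi'
      unfold zif
      split
      · exact (hi i hi').2
      · simp
    obtain ⟨s1, L, rfl, hs1, hL⟩ := ih (s ++ k :: (k + 1) :: zif (k + 1) m Z) v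
      (fun i hi => hA i (by omega)) (by
        intro i hi'
        have := hi i (by omega)
        have h4 := hz i (by omega)
        refine ⟨?_, this.2⟩
        simp; exact ⟨this.1, by omega, by omega, h4⟩)
      (by simpa [B2, idl] using h) (by simpa [B2, idl] using h1) h2
    obtain ⟨P', R', hv, hP'⟩ := hA k (by omega) _ _ s k
      ((k + 1) :: zif (k + 1) m Z ++ B2 idl Z m k) h h1 h2 (by simp [B2, idl])
      (hi k (by omega)).1 (by
        apply nb
        intro i hi'
        have := hi i (by omega)
        refine ⟨this.1, ?_, this.2⟩
        simp; exact ⟨by omega, hz i (by omega)⟩)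
    have hl1 := hs1.length_eq
    have hl2 := hP'.length_eq
    simp at hl1
    rcases List.append_eq_append_iff.1 hv with ⟨t, rfl, -⟩ | ⟨t, rfl, ht⟩
    · simp at hl2; omega
    · rcases t with _ | ⟨c, σ⟩
      · simp at hl1; omega
      · simp only [List.cons_append, List.cons.injEq] at ht
        obtain ⟨rfl, rfl⟩ := ht
        refine ⟨P', k :: (σ ++ L), by simp, hP', σ, L, rfl, ?_, hL⟩
        have := (List.Perm.append_right (k :: (k + 1) :: zif (k + 1) m Z) hP').trans hs1.symm
        exact ((List.perm_append_left_iff _).1 this).symm.cons_inv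

/-! ### Restriction and renaming of words -/

def res (S : List ℕ) (h : ℕ → ℕ) (w : List ℕ) : List ℕ :=
  (w.filter (fun a => decide (a ∈ S))).map h

theorem res_append (S h) (u v : List ℕ) : res S h (u ++ v) = res S h u ++ res S h v := by
  simp [res]

theorem res_cons_mem {S h a} {w : List ℕ} (ha : a ∈ S) : res S h (a :: w) = h a :: res S h w := by
  simp [res, ha]

theorem res_cons_not_mem {S h a} {w : List ℕ} (ha : a ∉ S) :
    res S h (a :: w) = res S h w := by
  simp [res, ha]

theorem res_nil' {S h} {w : List ℕ} (hw : ∀ a ∈ w, a ∉ S) : res S h w = [] := by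
  simp only [res, List.map_eq_nil_iff, List.filter_eq_nil_iff, decide_eq_true_eq]
  exact hw

theorem not_mem_of_res_nil {S h} {w : List ℕ} (hw : res S h w = []) : ∀ a ∈ w, a ∉ S := by
  simpa only [res, List.map_eq_nil_iff, List.filter_eq_nil_iff, decide_eq_true_eq] using hw

theorem res_flatMap (S h) (w : List ℕ) :
    w.flatMap (fun a => if a ∈ S then [h a] else []) = res S h w := by
  induction w with
  | nil => rfl
  | cons a w ih =>
    by_cases ha : a ∈ S
    · rw [res_cons_mem ha, ← ih]; simp [ha]
    · rw [res_cons_not_mem ha, ← ih]; simp [ha]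

theorem res_rel (hθ : FIC θ) (S h) {u v : List ℕ} (e : θ u v) : θ (res S h u) (res S h v) := by
  have := hθ.subst (fun a => if a ∈ S then [h a] else []) e
  rwa [res_flatMap, res_flatMap] at this

theorem mem_res {S h c} {w : List ℕ} : c ∈ res S h w ↔ ∃ a ∈ w, a ∈ S ∧ h a = c := by
  simp [res, and_assoc]

theorem res_nrm {S h} (hi : ∀ a ∈ S, ∀ b ∈ S, h a = h b → a = b) {w : List ℕ} (hw : Nrm w) :
    Nrm (res S h w) := by
  intro c
  by_cases hc : c ∈ res S h w
  · obtain ⟨a, haw, haS, rfl⟩ := mem_res.1 hc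
    refine le_trans ?_ (hw a)
    rw [res, List.count, List.countP_map, List.countP_filter]
    apply List.countP_mono_left
    intro b _ hb
    simp at hb
    simpa using hi b hb.2 a haS hb.1
  · rw [count_zero_of hc]; omega

theorem exists_h0 (f : ℕ → ℕ) (j : ℕ) (hf : ∀ i ≤ j, ∀ i' ≤ j, f i = f i' → i = i') :
    ∃ h : ℕ → ℕ, ∀ i ≤ j, h (f i) = i := by
  have : Set.InjOn f (Set.Iic j) := fun i hi i' hi' e => hf i hi i' hi' e
  exact ⟨Function.invFunOn f (Set.Iic j), fun i hi => this.leftInvOn_invFunOn hi⟩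

/-! ### Extraction of canonical identities -/

def gsub (S : List ℕ) (h : ℕ → ℕ) (y j : ℕ) : ℕ → List ℕ := fun a =>
  if a = y then [j + 2] else if a ∈ S then
    (if h a + 1 = j then [j + 2, j + 2, h a] else [h a]) else []

theorem gsub_del (hθ : FIC θ) {S : List ℕ} {h : ℕ → ℕ} {y j : ℕ} (hy : y ∉ S) (R : List ℕ) :
    ∀ (p r : List ℕ), 2 ≤ p.count (j + 2) →
    θ (p ++ (R.flatMap (gsub S h y j) ++ r)) (p ++ (res S h R ++ r)) := by
  induction R with
  | nil => intro p r _; exact hθ.refl _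
  | cons c R ih =>
    intro p r hp
    by_cases hcy : c = y
    · subst hcy
      have e1 := ih (p ++ [j + 2]) r (by rw [List.count_append]; omega)
      have e2 := hθ.ins1 hp (res S h R ++ r)
      rw [res_cons_not_mem hy]
      simp [gsub] at e1 e2 ⊢
      exact hθ.trans e1 (hθ.symm e2)
    · by_cases hcS : c ∈ S
      · rw [res_cons_mem hcS]
        have e1 := fun p' => ih (p ++ p' ++ [h c]) r (by simp only [List.count_append]; omega)
        by_cases hj : h c + 1 = j
        · have e0 := e1 [j + 2, j + 2]
          have e2 := hθ.ins (p := p) (w := [j + 2, j + 2]) (by simpa using hp)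
            (h c :: (res S h R ++ r))
          simp [gsub, hcy, hcS, hj] at e0 e2 ⊢
          exact hθ.trans e0 (hθ.symm e2)
        · have e0 := e1 []
          simp [gsub, hcy, hcS, hj] at e0 ⊢
          exact e0
      · rw [res_cons_not_mem hcS]
        simpa [gsub, hcy, hcS] using ih p r hp

theorem gsub_tail (hθ : FIC θ) {S : List ℕ} {h : ℕ → ℕ} {y j : ℕ} (hy : y ∉ S) (R : List ℕ) :
    ∀ (p : List ℕ), res S h R = cw 0 j →
    θ (p ++ (R.flatMap (gsub S h y j) ++ [j + 2, j + 2])) (p ++ ((j + 2) :: (j + 2) :: cw 0 j)) := by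
  induction R with
  | nil =>
    intro p hr
    rw [← hr]
    exact hθ.refl _
  | cons c R ih =>
    intro p hr
    by_cases hcy : c = y
    · subst hcy
      rw [res_cons_not_mem hy] at hr
      have e1 := ih (p ++ [j + 2]) hr
      have e2 := hθ.ins1 (p := p ++ [j + 2, j + 2]) (a := j + 2) (by simp) (cw 0 j)
      simp [gsub] at e1 e2 ⊢
      exact hθ.trans e1 (hθ.symm e2)
    · by_cases hcS : c ∈ S
      · rw [res_cons_mem hcS] at hr
        have hj : h c + 1 = j := by
          rcases j with _ | j
          · simp [cw, B2] at hr
          · simp [cw, B2, idl] at hr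
            omega
        have e1 := gsub_del hθ (j := j) (h := h) hy R (p ++ [j + 2, j + 2, h c]) [j + 2, j + 2]
          (by simp [List.count_cons]; omega)
        have e2 := hθ.ins (p := p ++ [j + 2, j + 2, h c] ++ res S h R) (w := [j + 2, j + 2])
          (by simp [List.count_cons]; omega) []
        rw [← hr]
        simp [gsub, hcy, hcS, hj] at e1 e2 ⊢
        exact hθ.trans e1 (hθ.symm e2)
      · rw [res_cons_not_mem hcS] at hr
        simpa [gsub, hcy, hcS] using ih p hr

theorem gsub_pre {S : List ℕ} {h : ℕ → ℕ} {y j : ℕ} {P : List ℕ} (hP : ∀ a ∈ P, a ∉ S) :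
    P.flatMap (gsub S h y j) = List.replicate (P.count y) (j + 2) := by
  induction P with
  | nil => rfl
  | cons c P ih =>
    have := ih (fun a ha => hP a (by simp [ha]))
    rw [List.flatMap_cons, this]
    by_cases hc : c = y
    · subst hc
      simp [gsub, List.replicate_succ]
    · simp [gsub, hc, hP c (by simp)]

theorem eW_rep (hθ : FIC θ) (a j : ℕ) :
    θ (List.replicate a (j + 2) ++ j :: ((j + 2) :: (j + 2) :: cw 0 j)) (eW a j) := by
  match a with
  | 0 => exact hθ.refl _
  | 1 =>
    have := hθ.ins1 (p := [j + 2, j, j + 2]) (a := j + 2) (by simp) (cw 0 j)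
    exact hθ.symm this
  | n + 2 =>
    have e1 := hθ.ins (p := [j + 2, j + 2]) (w := List.replicate n (j + 2)) (by
      intro a ha
      have := List.eq_of_mem_replicate ha
      subst this
      simp) (j :: ((j + 2) :: (j + 2) :: cw 0 j))
    have e2 := hθ.ins (p := [j + 2, j + 2, j]) (w := [j + 2, j + 2]) (by simp) (cw 0 j)
    simp [List.replicate_succ, eW, eP] at e1 e2 ⊢
    exact hθ.trans (hθ.symm e1) (hθ.symm e2)

theorem eW_succ (hθ : FIC θ) {a a' j : ℕ} (h : θ (eW a j) (eW a' j)) :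
    θ (eW (a + 1) j) (eW (a' + 1) j) := by
  have key : ∀ a, θ ((j + 2) :: eW a j) (eW (a + 1) j) := by
    intro a
    have e1 := hθ.mul [j + 2] [] (eW_rep hθ a j)
    have e2 := eW_rep hθ (a + 1) j
    simp [List.replicate_succ] at e1 e2
    exact hθ.trans (hθ.symm e1) e2
  have := hθ.mul [j + 2] [] h
  simp at this
  exact hθ.trans (hθ.symm (key a)) (hθ.trans this (key a'))

theorem eta_of (hθ : FIC θ) {a a' j : ℕ} (h : θ (eW a j) (eW a' j)) (ha : a ≤ 2) (ha' : a' ≤ 2)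
    (hne : a ≠ a') : Eta θ j := by
  have h2 := eW_succ hθ h
  have h3 := hθ.symm h
  have h4 := hθ.symm h2
  unfold Eta
  have c1 : a = 0 ∨ a = 1 ∨ a = 2 := by omega
  have c2 : a' = 0 ∨ a' = 1 ∨ a' = 2 := by omega
  rcases c1 with rfl | rfl | rfl <;> rcases c2 with rfl | rfl | rfl <;>
    first | exact absurd rfl hne | assumption

theorem beta_of (hθ : FIC θ) {a j : ℕ} (h : θ (eW 0 j) (eW a j)) (ha : a ≤ 2)
    (hne : 0 ≠ a) : Beta θ j := by
  have he := eta_of hθ h (by omega) ha hne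
  have : a = 1 ∨ a = 2 := by omega
  rcases this with rfl | rfl
  · exact hθ.symm h
  · exact hθ.trans (hθ.symm he) (hθ.symm h)

theorem chS_inj {f h : ℕ → ℕ} {j : ℕ} (hh : ∀ i ≤ j, h (f i) = i) :
    ∀ a ∈ chS f [] j, ∀ b ∈ chS f [] j, h a = h b → a = b := by
  intro a ha b hb e
  rcases mem_chS.1 ha with ⟨i, hi, rfl⟩ | h0
  · rcases mem_chS.1 hb with ⟨i', hi', rfl⟩ | h0
    · rw [hh i hi, hh i' hi'] at e
      rw [e]
    · simp at h0
  · simp at h0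

theorem extraction (hθ : FIC θ) (hP : HP θ) {j : ℕ} (hA : ∀ i < j, Agr θ i)
    {u v P P' R R' : List ℕ} {x y : ℕ} (e : θ u v) (hu : Nrm u) (hv : Nrm v)
    (hu' : u = P ++ x :: R) (hxP : x ∉ P) (hd : dge j (P ++ [x]) R x)
    (hnd : ¬ dge (j + 1) (P ++ [x]) R x) (hv' : v = P' ++ x :: R') (hxP' : x ∉ P')
    (hyx : y ≠ x) : θ (eW (P.count y) j) (eW (P'.count y) j) := by
  obtain ⟨f, hfj, hfP, hfi, hfc⟩ := chainLem [] (by simp) 0 j (P ++ [x]) R x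
    (by simpa [← hu'] using hu) (by simp [count_zero_of hxP]) hd hnd (by simp) (by simp)
  obtain ⟨h, hh⟩ := exists_h0 f j hfi
  have hinj := chS_inj hh
  have hxS : x ∈ chS f [] j := mem_chS.2 (Or.inl ⟨j, le_rfl, hfj⟩)
  have hhx : h x = j := by rw [← hfj]; exact hh j le_rfl
  have hPS : ∀ a ∈ P, a ∉ chS f [] j := by
    intro a ha haS
    rcases mem_chS.1 haS with ⟨i, hi, rfl⟩ | h0
    · rcases Nat.lt_or_ge i j with hij | hij
      · exact hfP i hij (by simp [ha])
      · have : i = j := by omega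
        subst this
        rw [hfj] at ha
        exact hxP ha
    · simp at h0
  have hRc : res (chS f [] j) h R = cw 0 j := by
    have := (hfc.map h).congr (g := fun i => i) (fun i hi => hh i hi)
    exact this.eq
  have hur : res (chS f [] j) h u = [j] ++ B2 idl [] 0 j := by
    rw [hu', res_append, res_nil' hPS, res_cons_mem hxS, hRc, hhx]
    simp [cw, B2_zero (Z' := [])]
  have e0 := res_rel hθ (chS f [] j) h e
  rw [hur] at e0
  obtain ⟨s', L, hsL, hs', hL⟩ := cLem hP j [j] _ hA (by simp; omega) e0
    (by rw [← hur]; exact res_nrm hinj hu) (res_nrm hinj hv)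
  have hs'' : s' = [j] := by simpa using hs'
  have hL' : L = cw 0 j := hL.eq
  rw [hs'', hL', hv', res_append, res_cons_mem hxS, hhx] at hsL
  have hP'r : res (chS f [] j) h P' = [] := by
    rcases hr : res (chS f [] j) h P' with _ | ⟨c, T⟩
    · rfl
    · exfalso
      rw [hr] at hsL
      simp at hsL
      have : c ∈ res (chS f [] j) h P' := by rw [hr]; simp
      obtain ⟨a, ha, haS, hac⟩ := mem_res.1 this
      have : a = x := hinj a haS x hxS (by rw [hac, hsL.1, hhx])
      exact hxP' (this ▸ ha)
  rw [hP'r] at hsL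
  have hR'c : res (chS f [] j) h R' = cw 0 j := by simpa using hsL
  have hP'S := not_mem_of_res_nil hP'r
  by_cases hyS : y ∈ chS f [] j
  · rw [count_zero_of (fun hy => hPS y hy hyS), count_zero_of (fun hy => hP'S y hy hyS)]
    exact hθ.refl _
  · have hgx : gsub (chS f [] j) h y j x = [j] := by
      simp [gsub, hyx.symm, hxS, hhx]
    have key : ∀ {P R : List ℕ}, (∀ a ∈ P, a ∉ chS f [] j) → res (chS f [] j) h R = cw 0 j →
        θ ((P ++ x :: R).flatMap (gsub (chS f [] j) h y j) ++ [j + 2, j + 2])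
          (eW (P.count y) j) := by
      intro P R h1 h2
      have e1 := gsub_tail hθ hyS R (List.replicate (P.count y) (j + 2) ++ [j]) h2
      have e2 := eW_rep hθ (P.count y) j
      rw [List.flatMap_append, gsub_pre h1, List.flatMap_cons, hgx]
      simp at e1 e2 ⊢
      exact hθ.trans e1 e2
    have e3 := hθ.mul [] [j + 2, j + 2] (hθ.subst (gsub (chS f [] j) h y j) e)
    rw [hu', hv'] at e3
    exact hθ.trans (hθ.symm (key hPS hRc)) (hθ.trans e3 (key hP'S hR'c))

theorem exists_exact {P R : List ℕ} {x j : ℕ} (h : ¬ dge (j + 1) P R x) :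
    ∃ j' ≤ j, dge j' P R x ∧ ¬ dge (j' + 1) P R x := by
  induction j with
  | zero => exact ⟨0, le_rfl, trivial, h⟩
  | succ j ih =>
    by_cases h' : dge (j + 1) P R x
    · exact ⟨j + 1, le_rfl, h', h⟩
    · obtain ⟨j', h1, h2⟩ := ih h'
      exact ⟨j', by omega, h2⟩

theorem count_le_of_app {P R : List ℕ} (h : Nrm (P ++ R)) (y : ℕ) : P.count y ≤ 2 := by
  have := h y
  rw [List.count_append] at this
  omega

theorem agr_of (hθ : FIC θ) (hP : HP θ) {k : ℕ} (hne : ∀ i < k, ¬ Eta θ i) :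
    ∀ j < k, Agr θ j := by
  intro j
  induction j using Nat.strong_induction_on with
  | _ j ih =>
    intro hj u v P x R e hu hv hu' hxP hnd
    obtain ⟨j', hj', hd', hnd'⟩ := exists_exact hnd
    have hxv : x ∈ v := (hP u v e hu hv).mem_iff.1 (by simp [hu'])
    obtain ⟨P', b, R', hv', rfl, hP'⟩ := first_split (p := fun a => a = x) ⟨x, hxv, rfl⟩
    refine ⟨P', R', hv', ?_⟩
    rw [List.perm_iff_count]
    intro y
    have hbP' : b ∉ P' := fun hh => hP' b hh rfl
    by_cases hyx : y = b
    · subst hyx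
      rw [count_zero_of hxP, count_zero_of hbP']
    · have e1 := extraction hθ hP (fun i hi => ih i (by omega) (by omega)) e hu hv hu' hxP hd'
        hnd' hv' hbP' hyx
      by_contra hc
      exact hne j' (by omega) (eta_of hθ e1 (count_le_of_app (hu' ▸ hu) y)
        (count_le_of_app (hv' ▸ hv) y) (fun hh => hc hh.symm))

end KHFB
namespace KHFB

/-! ### Swapping adjacent letters -/

variable {θ χ : List ℕ → List ℕ → Prop}

theorem Nrm.perm {u v : List ℕ} (h : Nrm u) (hp : u.Perm v) : Nrm v := by
  intro c
  rw [← hp.count_eq]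
  exact h c

theorem dge_skip {k P w r a} (hw : ∀ c ∈ w, c ∈ P) (h : dge k P r a) : dge k P (w ++ r) a := by
  apply dge_unshift'
  · intro c hc hcP
    exact absurd (hw c hc) hcP
  · exact dge_sub (fun c => by simp) h

theorem swapInf (h : FIC χ) {P R : List ℕ} {x y K : ℕ} (hK : R.length < K)
    (hx : dge K (P ++ [x, y]) R x) (hy : dge K (P ++ [x, y]) R y) :
    χ (P ++ x :: y :: R) (P ++ y :: x :: R) := by
  obtain ⟨q, r2, rfl, hq⟩ := dge_close K (P ++ [x, y]) R [x, y] hK (by simp [hx, hy])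
  have key : ∀ p : List ℕ, (∀ c, P.count c ≤ p.count c) → ∀ a ∈ x :: y :: q,
      2 ≤ (p ++ x :: y :: q).count a := by
    intro p hp a ha
    have h1 := hq a (by simpa using ha)
    have h2 := hp a
    simp only [List.append_assoc, List.count_append, List.cons_append, List.nil_append] at h1 ⊢
    omega
  have key' : ∀ p : List ℕ, (∀ c, P.count c ≤ p.count c) → ∀ a ∈ y :: x :: q,
      2 ≤ (p ++ y :: x :: q).count a := by
    intro p hp a ha
    have h1 := key p hp a (by simp at ha ⊢; tauto)
    have : (p ++ x :: y :: q).Perm (p ++ y :: x :: q) :=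
      List.Perm.append_left _ (List.Perm.swap _ _ _)
    rwa [← this.count_eq]
  have hc : ∀ c, P.count c ≤ (P ++ [x, x]).count c := by
    intro c; rw [List.count_append]; omega
  have e1 := h.sq (key P (fun c => le_rfl)) (x := x) (by simp) r2
  have e2 := h.sq (key (P ++ [x, x]) hc) (x := y) (by simp) r2
  have e3 := h.sq (key' (P ++ [x, x]) hc) (x := y) (by simp) r2
  have e4 := h.sq (key' P (fun c => le_rfl)) (x := x) (by simp) r2
  have e5 := h.swap22 (p := P ++ [x, x, y, y]) (a := x) (b := y) (by simp) (by simp) (q ++ r2)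
  simp at e1 e2 e3 e4 e5 ⊢
  exact h.trans e1 (h.trans e2 (h.trans e5 (h.trans (h.symm e3) (h.symm e4))))

theorem swap11A_aux (h : FIC χ) {k : ℕ} (he : Eta χ k) {P q r2 : List ℕ} {x y : ℕ}
    (hx : 2 ≤ (P ++ [x, y] ++ q).count x) (hy : 2 ≤ (P ++ [x, y] ++ q).count y)
    (hq : ∀ a ∈ q, dge k (P ++ [x, y] ++ q) r2 a) :
    χ (P ++ x :: y :: (q ++ r2)) (P ++ x :: x :: y :: y :: (q ++ r2)) := by
  have e1 := h.ins (p := P ++ [x, y] ++ q) (w := [x, y]) (by simp at hx hy ⊢; tauto) r2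
  have e2 := der_eta h he (p := P) (y := x) (X := y :: q) (r := y :: r2) (by
    intro a ha
    rcases List.mem_cons.1 ha with rfl | ha
    · apply dge_of_count
      refine le_trans hy ?_
      simp [List.count_cons]
    · have := dge_skip (w := [y]) (by simp) (dge_sub (P' := P ++ x :: (y :: q ++ [x])) (by
        intro c; simp [List.count_cons]) (hq a ha))
      simpa using this)
  have e3 := der_eta h he (p := P ++ [x, x]) (y := y) (X := q) (r := r2) (by
    intro a ha
    refine dge_sub ?_ (hq a ha)
    intro c
    simp [List.count_cons]; omega)
  simp at e1 e2 e3 ⊢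
  exact h.trans e1 (h.trans e2 e3)

theorem swap_perm (P : List ℕ) (x y : ℕ) (q : List ℕ) (c : ℕ) :
    (P ++ x :: y :: q).count c = (P ++ y :: x :: q).count c :=
  (List.Perm.append_left P (List.Perm.swap y x q)).count_eq c

theorem swap11A (h : FIC χ) {k : ℕ} (he : Eta χ k) {P R : List ℕ} {x y : ℕ}
    (hx : dge (k + 1) (P ++ [x, y]) R x) (hy : dge (k + 1) (P ++ [x, y]) R y) :
    χ (P ++ x :: y :: R) (P ++ y :: x :: R) := by
  obtain ⟨q, r2, rfl, h1, h2⟩ := dge_split [x, y] (k := k) (P := P ++ [x, y]) (r := R)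
    (by simp [hx, hy])
  have h2 := dge_all h2
  have hs : ∀ c, (P ++ [x, y] ++ q).count c = (P ++ [y, x] ++ q).count c := by
    intro c
    have := swap_perm P x y q c
    simpa using this
  have e1 := swap11A_aux h he (h1 x (by simp)) (h1 y (by simp)) h2
  have e2 := swap11A_aux h he (P := P) (q := q) (r2 := r2) (x := y) (y := x)
    (by rw [← hs]; exact h1 y (by simp)) (by rw [← hs]; exact h1 x (by simp))
    (fun a ha => dge_sub (fun c => (hs c).le) (h2 a ha))
  have e3 := h.mul P (q ++ r2) (h.k2 [x] [y])
  simp at e1 e2 e3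
  exact h.trans e1 (h.trans e3 (h.symm e2))

theorem swap11B (h : FIC χ) {k : ℕ} (he : Beta χ k) {P R : List ℕ} {x y : ℕ}
    (hx : dge k (P ++ [x, y]) R x) (hy : dge (k + 1) (P ++ [x, y]) R y) :
    χ (P ++ x :: y :: R) (P ++ y :: x :: R) := by
  obtain ⟨q, r2, rfl, h1, h2⟩ := dge_split [y] (k := k) (P := P ++ [x, y]) (r := R)
    (by simp [hy])
  have h2 := dge_all h2
  have hx := dge_shift hx
  have hy' := h1 y (by simp)
  have e1 := h.ins (p := P ++ [x, y] ++ q) (w := [y]) (by simpa using hy') r2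
  have e2 := der_beta h he (p := P ++ [x]) (y := y) (X := q) (r := r2) (by
    intro a ha
    refine dge_sub ?_ (h2 a ha)
    intro c
    simp [List.count_cons])
  have e3 := h.ins (p := P ++ [y, x] ++ q) (w := [y]) (by
    have := swap_perm P x y q y
    simp only [List.append_assoc, List.cons_append, List.nil_append] at hy' ⊢
    simp only [List.mem_singleton, forall_eq]
    omega) r2
  have e4 := der_beta h he (p := P) (y := y) (X := x :: q) (r := r2) (by
    intro a ha
    have : dge k (P ++ [x, y] ++ q) r2 a := by
      rcases List.mem_cons.1 ha with rfl | ha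
      · exact hx
      · exact h2 a ha
    refine dge_sub ?_ this
    intro c
    have := swap_perm P x y q c
    simp [List.count_cons] at this ⊢)
  simp at e1 e2 e3 e4 ⊢
  exact h.trans e1 (h.trans e2 (h.symm (h.trans e3 e4)))

theorem swap12A (h : FIC χ) {k : ℕ} (he : Eta χ k) {P R : List ℕ} {x y : ℕ} (hyP : y ∈ P)
    (hx : dge (k + 1) (P ++ [x, y]) R x) :
    χ (P ++ x :: y :: R) (P ++ y :: x :: R) :=
  swap11A h he hx (dge_of_count (by
    have := count_pos_of hyP
    have h2 : 0 < [x, y].count y := count_pos_of (by simp)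
    rw [List.count_append]; omega))

theorem swap12B (h : FIC χ) {k : ℕ} (he : Eta χ k) {p Q R : List ℕ} {x y : ℕ}
    (hx : dge k (p ++ y :: Q ++ [x, y]) R x)
    (hQ : ∀ a ∈ Q, dge k (p ++ y :: Q ++ [x, y]) R a) :
    χ (p ++ y :: Q ++ x :: y :: R) (p ++ y :: Q ++ y :: x :: R) := by
  have hs : ∀ c, (p ++ y :: Q ++ [x, y]).count c ≤ (p ++ y :: (Q ++ [y]) ++ [x]).count c := by
    intro c
    have := swap_perm (p ++ y :: Q) x y [] c
    simp at this ⊢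
    omega
  have e1 := der_eta h he (p := p) (y := y) (X := Q) (r := x :: R) (by
    intro a ha
    refine dge_unshift' (q := [x]) ?_ ?_
    · intro c hc _
      simp at hc
      subst hc
      exact dge_sub hs hx
    · exact dge_sub hs (hQ a ha))
  have e2 := der_eta h he (p := p) (y := y) (X := Q ++ [x]) (r := R) (by
    intro a ha
    have : p ++ y :: (Q ++ [x] ++ [y]) = p ++ y :: Q ++ [x, y] := by simp
    rw [this]
    rcases List.mem_append.1 ha with ha | ha
    · exact hQ a ha
    · simp at ha
      subst ha
      exact hx)
  simp at e1 e2 ⊢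
  exact h.trans e2 (h.symm e1)

theorem swap12D (h : FIC χ) {k m : ℕ} (he : Delta χ k m) {p Q R : List ℕ} {x y : ℕ}
    (hx : dge k (p ++ y :: Q ++ [x, y]) R x)
    (hQ : ∀ a ∈ Q, dge m (p ++ y :: Q ++ [x, y]) R a) :
    χ (p ++ y :: Q ++ x :: y :: R) (p ++ y :: Q ++ y :: x :: R) := by
  have := der_delta h he (p := p) (Q := Q) (r := R) (x := x) (y := y) (by simpa using hx)
    (by simpa using hQ)
  simpa using this

/-! ### First occurrences in a swapped pair are deep -/

theorem first_uniq {P P' R R' : List ℕ} {a : ℕ} (h : P ++ a :: R = P' ++ a :: R') (h1 : a ∉ P)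
    (h2 : a ∉ P') : P = P' := by
  rcases List.append_eq_append_iff.1 h with ⟨t, rfl, h3⟩ | ⟨t, rfl, h3⟩
  · rcases t with _ | ⟨c, t⟩
    · simp
    · simp at h3
      exact absurd (by simp [h3.1]) h2
  · rcases t with _ | ⟨c, t⟩
    · simp
    · simp at h3
      exact absurd (by simp [h3.1]) h1

theorem deep_a {k : ℕ} (hA : ∀ i < k, Agr θ i) {W q R V : List ℕ} {b a : ℕ}
    (e : θ (W ++ q ++ b :: a :: R) (W ++ a :: V)) (hu : Nrm (W ++ q ++ b :: a :: R))
    (hv : Nrm (W ++ a :: V)) (hab : a ≠ b) (haP : a ∉ W ++ q) :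
    dge k (W ++ q ++ [b, a]) R a := by
  rcases k with _ | k
  · trivial
  · by_contra hd
    obtain ⟨P', R', h1, h2⟩ := hA k (by omega) _ _ (W ++ q ++ [b]) a R e hu hv (by simp)
      (by simp at haP ⊢; tauto) (by simpa using hd)
    have h3 : a ∉ P' := fun hh => by
      have := h2.mem_iff.1 hh
      simp at this haP; tauto
    have := first_uniq h1 (by simp at haP; tauto) h3
    have h4 := h2.length_eq
    subst this
    simp at h4

theorem before_b {W P' R' V : List ℕ} {b a : ℕ} (h : W ++ a :: V = P' ++ b :: R') (hab : a ≠ b)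
    (hb : b ∉ W) : W.count a < P'.count a := by
  rcases List.append_eq_append_iff.1 h with ⟨t, rfl, h3⟩ | ⟨t, rfl, h3⟩
  · rcases t with _ | ⟨c, t⟩
    · simp at h3; exact absurd h3.1 hab
    · simp at h3
      rw [h3.1]
      simp
  · rcases t with _ | ⟨c, t⟩
    · simp at h3; exact absurd h3.1.symm hab
    · simp at h3
      exact absurd (by simp [h3.1]) hb

theorem deep_b {k : ℕ} (hA : ∀ i < k, Agr θ i) {W q R V : List ℕ} {b a : ℕ}
    (e : θ (W ++ q ++ b :: a :: R) (W ++ a :: V)) (hu : Nrm (W ++ q ++ b :: a :: R))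
    (hv : Nrm (W ++ a :: V)) (hab : a ≠ b) (haq : a ∉ q) (hbP : b ∉ W ++ q) :
    dge k (W ++ q ++ [b]) (a :: R) b := by
  rcases k with _ | k
  · trivial
  · by_contra hd
    obtain ⟨P', R', h1, h2⟩ := hA k (by omega) _ _ (W ++ q) b (a :: R) e hu hv (by simp)
      hbP (by simpa using hd)
    have h3 := before_b h1 hab (by simp at hbP; tauto)
    have h4 := h2.count_eq a
    rw [List.count_append, count_zero_of haq] at h4
    omega

/-! ### Canonical identities in `θ` -/

theorem Chn.perm {f : ℕ → ℕ} {Z m k L} (hc : Chn f Z m k L) :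
    L.Perm (B2 (fun i => [f i]) Z m k) := by
  induction k generalizing L with
  | zero => simp [Chn] at hc; subst hc; exact List.Perm.refl _
  | succ k ih =>
    obtain ⟨σ, L', rfl, h2, h3⟩ := hc
    have := (h2.append (ih h3)).cons (f k)
    simpa [B2] using this

theorem canon_extract (hθ : FIC θ) (hP : HP θ) {k m : ℕ} (hA : ∀ i < k, Agr θ i)
    {u v S s L : List ℕ} {h : ℕ → ℕ} (hi : ∀ a ∈ S, ∀ b ∈ S, h a = h b → a = b)
    (e : θ u v) (hu : Nrm u) (hv : Nrm v) (hr : res S h u = s ++ L)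
    (hL : Chn (fun i => i) [k + 1] m k L) (hs : ∀ i < k, i ∉ s) (hks : k ∈ s)
    (hks' : k + 1 ∈ s) :
    ∃ s' L', res S h v = s' ++ L' ∧ s'.Perm s ∧ θ (s ++ cw m k) (s' ++ cw m k) := by
  have e0 := res_rel hθ S h e
  rw [hr] at e0
  have e1 : θ (s ++ L) (s ++ cw m k) := hL.rel hθ hks (by simpa using hks')
  have e2 := hθ.trans (hθ.symm e1) e0
  have hn : Nrm (s ++ cw m k) := by
    have := res_nrm hi hu
    rw [hr] at this
    exact this.perm (List.Perm.append_left _ hL.perm)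
  obtain ⟨s', L', h1, h2, h3⟩ := cLem hP k s _ hA
    (fun i hi => ⟨hs i hi, by simp; omega⟩) e2 hn (res_nrm hi hv)
  refine ⟨s', L', h1, h2, ?_⟩
  rw [h1] at e2
  have e3 : θ (s' ++ L') (s' ++ cw m k) := h3.rel hθ (h2.mem_iff.2 hks)
    (by simpa using h2.mem_iff.2 hks')
  exact hθ.trans e2 e3

theorem chS_inj1 {f h : ℕ → ℕ} {j z : ℕ} (hh : ∀ i ≤ j, h (f i) = i) (hz : h z = j + 1) :
    ∀ a ∈ chS f [z] j, ∀ b ∈ chS f [z] j, h a = h b → a = b := by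
  intro a ha b hb e
  rcases mem_chS.1 ha with ⟨i, hi, rfl⟩ | h0 <;> rcases mem_chS.1 hb with ⟨i', hi', rfl⟩ | h0'
  · rw [hh i hi, hh i' hi'] at e
    rw [e]
  · simp at h0'
    subst h0'
    rw [hh i hi, hz] at e
    omega
  · simp at h0
    subst h0
    rw [hh i' hi', hz] at e
    omega
  · simp at h0 h0'
    rw [h0, h0']

theorem chS_bound {f h : ℕ → ℕ} {j z : ℕ} (hh : ∀ i ≤ j, h (f i) = i) (hz : h z = j + 1) :
    ∀ a ∈ chS f [z] j, h a ≤ j + 1 := by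
  intro a ha
  rcases mem_chS.1 ha with ⟨i, hi, rfl⟩ | h0
  · rw [hh i hi]; omega
  · simp at h0
    subst h0
    omega

theorem alpha_of (hθ : FIC θ) (hP : HP θ) {k : ℕ} (hA : ∀ i < k, Agr θ i) {W q R V : List ℕ}
    {b a : ℕ} (e : θ (W ++ q ++ b :: a :: R) (W ++ a :: V)) (hu : Nrm (W ++ q ++ b :: a :: R))
    (hv : Nrm (W ++ a :: V)) (hab : a ≠ b) (haP : a ∉ W ++ q) (hbP : b ∉ W ++ q)
    (ha : dge k (W ++ q ++ [b, a]) R a) (hb : dge k (W ++ q ++ [b, a]) R b)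
    (hna : ¬ dge (k + 1) (W ++ q ++ [b, a]) R a) (hnb : ¬ dge (k + 1) (W ++ q ++ [b, a]) R b) :
    Alpha θ k := by
  have hca : (W ++ q ++ [b, a]).count a = 1 := by
    rw [List.count_append, count_zero_of haP]
    simp [hab.symm]
  have hcb : (W ++ q ++ [b, a]).count b = 1 := by
    rw [List.count_append, count_zero_of hbP]
    simp [hab]
  obtain ⟨f, hfk, hfP, hfi, hfc⟩ := chainLem [a] (by simp) k k (W ++ q ++ [b, a]) R b
    (by simpa using hu) hcb hb hnb (by simpa using hab.symm) (by
      intro z hz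
      simp at hz
      subst hz
      exact ⟨by simp, fun _ => ⟨hca, ha, hna⟩, fun hh => absurd hh (by omega)⟩)
  obtain ⟨h0, hh0⟩ := exists_h0 f k hfi
  have hfa : ∀ i ≤ k, f i ≠ a := by
    intro i hi hh
    rcases Nat.lt_or_ge i k with hik | hik
    · exact hfP i hik (by simp [hh])
    · have : i = k := by omega
      subst this
      exact hab (by rw [← hh, hfk])
  obtain ⟨h, hh, hha⟩ : ∃ h : ℕ → ℕ, (∀ i ≤ k, h (f i) = i) ∧ h a = k + 1 :=
    ⟨Function.update h0 a (k + 1), fun i hi => by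
      rw [Function.update_of_ne (hfa i hi)]; exact hh0 i hi, by simp⟩
  have hPS : ∀ c ∈ W ++ q, c ∉ chS f [a] k := by
    intro c hc hcS
    rcases mem_chS.1 hcS with ⟨i, hi, rfl⟩ | h0
    · rcases Nat.lt_or_ge i k with hik | hik
      · exact hfP i hik (List.mem_append.2 (Or.inl hc))
      · have : i = k := by omega
        subst this
        rw [hfk] at hc
        exact hbP hc
    · simp at h0
      subst h0
      exact haP hc
  have hbS : b ∈ chS f [a] k := mem_chS.2 (Or.inl ⟨k, le_rfl, hfk⟩)
  have haS : a ∈ chS f [a] k := mem_chS.2 (Or.inr (by simp))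
  have hhb : h b = k := by rw [← hfk]; exact hh k le_rfl
  have hL : Chn (fun i => i) [k + 1] k k (res (chS f [a] k) h R) := by
    have := (hfc.map h).congr (g := fun i => i) (fun i hi => hh i hi)
    simp only [List.map_cons, List.map_nil, hha] at this
    exact this
  obtain ⟨s', L', h1, h2, h3⟩ := canon_extract hθ hP hA (chS_inj1 hh hha) e hu hv
    (s := [k, k + 1]) (by
      rw [res_append, res_nil' hPS, res_cons_mem hbS, res_cons_mem haS, hhb, hha]
      rfl) hL (by simp; omega) (by simp) (by simp)
  rw [res_append, res_nil' (fun c hc => hPS c (by simp [hc])), res_cons_mem haS, hha] at h1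
  have : s' = [k + 1, k] := by
    rcases s' with _ | ⟨c, s'⟩
    · have := h2.length_eq; simp at this
    · simp at h1
      obtain ⟨rfl, -⟩ := h1
      have h4 := h2.trans (List.Perm.swap (k + 1) k [])
      have h5 := h4.cons_inv
      simp at h5
      rw [h5]
  rw [this] at h3
  exact h3

end KHFB
namespace KHFB

variable {θ χ : List ℕ → List ℕ → Prop}

theorem delta_of (hθ : FIC θ) (hP : HP θ) {k m : ℕ} (hA : ∀ i < k, Agr θ i)
    {W q R V p Q : List ℕ} {b a x y z : ℕ} (e : θ (W ++ q ++ b :: a :: R) (W ++ a :: V))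
    (hu : Nrm (W ++ q ++ b :: a :: R)) (hv : Nrm (W ++ a :: V)) (haq : a ∉ q)
    (hba : (b = x ∧ a = y) ∨ (b = y ∧ a = x)) (hxy : x ≠ y) (hpQ : W ++ q = p ++ y :: Q)
    (hyp : y ∉ p) (hyQ : y ∉ Q) (hxP : x ∉ W ++ q) (hmk : m < k)
    (hx : dge k (W ++ q ++ [b, a]) R x) (hnx : ¬ dge (k + 1) (W ++ q ++ [b, a]) R x)
    (hzQ : z ∈ Q) (hz : dge m (W ++ q ++ [b, a]) R z)
    (hnz : ¬ dge (m + 1) (W ++ q ++ [b, a]) R z) : Delta θ k m := by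
  have hzP : z ∈ W ++ q := by rw [hpQ]; simp [hzQ]
  have hzx : z ≠ x := by rintro rfl; exact hxP hzP
  have hzy : z ≠ y := by rintro rfl; exact hyQ hzQ
  have hxm : x ∈ [b, a] := by rcases hba with ⟨rfl, rfl⟩ | ⟨rfl, rfl⟩ <;> simp
  have hym : y ∈ [b, a] := by rcases hba with ⟨rfl, rfl⟩ | ⟨rfl, rfl⟩ <;> simp
  have hcx : (W ++ q ++ [b, a]).count x = 1 := by
    rw [List.count_append, count_zero_of hxP]
    rcases hba with ⟨rfl, rfl⟩ | ⟨rfl, rfl⟩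
    · simp [hxy.symm]
    · simp [hxy.symm]
  have hcz : (W ++ q ++ [b, a]).count z = 1 := by
    have h1 : ¬ 2 ≤ (W ++ q ++ [b, a]).count z := fun hh => hnz (dge_of_count hh)
    have h2 := count_pos_of (l := W ++ q ++ [b, a]) (a := z) (List.mem_append.2 (Or.inl hzP))
    omega
  have hyR : y ∉ R := by
    intro hh
    have h1 := count_two (P := W ++ q) (q := [b, a]) (a := y) (by rw [hpQ]; simp) hym
    have h2 := count_pos_of hh
    have h3 := hu y
    have h4 : W ++ q ++ b :: a :: R = W ++ q ++ [b, a] ++ R := by simp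
    rw [h4, List.count_append] at h3
    omega
  obtain ⟨f, hfk, hfP, hfi, hfc⟩ := chainLem [z] (by simp) m k (W ++ q ++ [b, a]) R x
    (by simpa using hu) hcx hx hnx (by simpa using hzx.symm) (by
      intro z' hz'
      simp at hz'
      subst hz'
      exact ⟨List.mem_append.2 (Or.inl hzP), fun _ => ⟨hcz, hz, hnz⟩,
        fun hh => absurd hh (by omega)⟩)
  have hfne : ∀ c, c ∈ W ++ q ++ [b, a] → c ≠ x → ∀ i ≤ k, f i ≠ c := by
    intro c hc hcx i hi hh
    rcases Nat.lt_or_ge i k with hik | hik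
    · exact hfP i hik (by rw [hh]; exact hc)
    · have : i = k := by omega
      subst this
      exact hcx (by rw [← hh, hfk])
  have hfz := hfne z (List.mem_append.2 (Or.inl hzP)) hzx
  have hfy := hfne y (List.mem_append.2 (Or.inr hym)) hxy.symm
  obtain ⟨h0, hh0⟩ := exists_h0 f k hfi
  obtain ⟨h, hh, hhz, hhy⟩ : ∃ h : ℕ → ℕ, (∀ i ≤ k, h (f i) = i) ∧ h z = k + 1 ∧ h y = k + 2 :=
    ⟨Function.update (Function.update h0 z (k + 1)) y (k + 2), fun i hi => by
      rw [Function.update_of_ne (hfy i hi), Function.update_of_ne (hfz i hi)]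
      exact hh0 i hi, by rw [Function.update_of_ne hzy]; simp, by simp⟩
  have hyS : y ∉ chS f [z] k := by
    intro hy
    rcases mem_chS.1 hy with ⟨i, hi, h1⟩ | h1
    · exact hfy i hi h1
    · simp at h1; exact hzy h1.symm
  have hinj : ∀ c ∈ y :: chS f [z] k, ∀ d ∈ y :: chS f [z] k, h c = h d → c = d := by
    intro c hc d hd hcd
    rcases List.mem_cons.1 hc with hc1 | hc1 <;> rcases List.mem_cons.1 hd with hd1 | hd1
    · rw [hc1, hd1]
    · have := chS_bound hh hhz d hd1; rw [hc1] at hcd; omega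
    · have := chS_bound hh hhz c hc1; rw [hd1] at hcd; omega
    · exact chS_inj1 hh hhz c hc1 d hd1 hcd
  have hxS : x ∈ y :: chS f [z] k := by
    refine List.mem_cons_of_mem _ (mem_chS.2 (Or.inl ⟨k, le_rfl, hfk⟩))
  have hzS : z ∈ y :: chS f [z] k := List.mem_cons_of_mem _ (mem_chS.2 (Or.inr (by simp)))
  have hyS' : y ∈ y :: chS f [z] k := by simp
  have hhx : h x = k := by rw [← hfk]; exact hh k le_rfl
  have hPS : ∀ c ∈ W ++ q, c ∈ y :: chS f [z] k → c = y ∨ c = z := by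
    intro c hc hcS
    rcases List.mem_cons.1 hcS with rfl | hcS
    · exact Or.inl rfl
    · rcases mem_chS.1 hcS with ⟨i, hi, h1⟩ | h1
      · exfalso
        exact hfne c (List.mem_append.2 (Or.inl hc)) (by rintro rfl; exact hxP hc) i hi h1
      · simp at h1; exact Or.inr h1
  obtain ⟨Q1, Q2, rfl⟩ := List.append_of_mem hzQ
  have hcz' : (p ++ y :: (Q1 ++ z :: Q2)).count z ≤ 1 := by
    rw [← hpQ, ← hcz]
    rw [List.count_append (l₂ := [b, a])]
    omega
  have hzp : z ∉ p := by
    intro h1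
    have := count_two (P := p) (q := y :: (Q1 ++ z :: Q2)) h1 (by simp)
    omega
  have hzQ1 : z ∉ Q1 := by
    intro h1
    have := count_two (P := p ++ y :: Q1) (q := z :: Q2) (a := z) (by simp [h1]) (by simp)
    simp at this hcz'
    omega
  have hzQ2 : z ∉ Q2 := by
    intro h1
    have := count_two (P := p ++ y :: (Q1 ++ [z])) (q := Q2) (a := z) (by simp) h1
    simp at this hcz'
    omega
  simp only [List.mem_append, List.mem_cons, not_or] at hyQ
  have rp : res (y :: chS f [z] k) h p = [] := res_nil' (by
    intro c hc hcS
    rcases hPS c (by rw [hpQ]; simp [hc]) hcS with rfl | rfl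
    · exact hyp hc
    · exact hzp hc)
  have rQ1 : res (y :: chS f [z] k) h Q1 = [] := res_nil' (by
    intro c hc hcS
    rcases hPS c (by rw [hpQ]; simp [hc]) hcS with rfl | rfl
    · exact hyQ.1 hc
    · exact hzQ1 hc)
  have rQ2 : res (y :: chS f [z] k) h Q2 = [] := res_nil' (by
    intro c hc hcS
    rcases hPS c (by rw [hpQ]; simp [hc]) hcS with rfl | rfl
    · exact hyQ.2.2 hc
    · exact hzQ2 hc)
  have rp1 : res (y :: chS f [z] k) h (p ++ y :: Q1) = [k + 2] := by
    rw [res_append, rp, res_cons_mem hyS', rQ1, hhy]; rfl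
  have rP : res (y :: chS f [z] k) h (W ++ q) = [k + 2, k + 1] := by
    rw [hpQ, res_append, rp, res_cons_mem hyS', res_append, rQ1, res_cons_mem hzS, rQ2, hhy, hhz]
    rfl
  have rR : res (y :: chS f [z] k) h R = res (chS f [z] k) h R := by
    unfold res
    congr 1
    apply List.filter_congr
    intro c hc
    have : c ≠ y := by rintro rfl; exact hyR hc
    simp [this]
  have hL : Chn (fun i => i) [k + 1] m k (res (y :: chS f [z] k) h R) := by
    have := (hfc.map h).congr (g := fun i => i) (fun i hi => hh i hi)
    simp only [List.map_cons, List.map_nil, hhz] at this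
    rw [rR]
    exact this
  have hbS : b ∈ y :: chS f [z] k := by
    rcases hba with ⟨rfl, rfl⟩ | ⟨rfl, rfl⟩ <;> assumption
  have haS : a ∈ y :: chS f [z] k := by
    rcases hba with ⟨rfl, rfl⟩ | ⟨rfl, rfl⟩ <;> assumption
  have hbk : h b = k ∧ h a = k + 2 ∨ h b = k + 2 ∧ h a = k := by
    rcases hba with ⟨rfl, rfl⟩ | ⟨rfl, rfl⟩
    · exact Or.inl ⟨hhx, hhy⟩
    · exact Or.inr ⟨hhy, hhx⟩
  have haz : a ≠ z := by
    rcases hba with ⟨rfl, rfl⟩ | ⟨rfl, rfl⟩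
    · exact hzy.symm
    · exact hzx.symm
  obtain ⟨s', L', h1, h2, h3⟩ := canon_extract hθ hP hA hinj e hu hv
    (s := [k + 2, k + 1, h b, h a]) (by
      rw [res_append, rP, res_cons_mem hbS, res_cons_mem haS]
      rfl) hL (by
        intro i hi
        simp
        rcases hbk with ⟨h4, h5⟩ | ⟨h4, h5⟩ <;> rw [h4, h5] <;> omega) (by
        rcases hbk with ⟨h4, h5⟩ | ⟨h4, h5⟩ <;> simp [h4, h5]) (by simp)
  -- the beginning of `v`
  obtain ⟨P', R', hv', hP'⟩ := hA m hmk _ _ (p ++ y :: Q1) z (Q2 ++ b :: a :: R) e hu hv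
    (by rw [hpQ]; simp) (by simp; exact ⟨hzp, hzy, hzQ1⟩) (by
      intro h4
      apply hnz
      have h5 : dge (m + 1) (p ++ y :: Q1 ++ [z]) ((Q2 ++ [b, a]) ++ R) z := by simpa using h4
      have := dge_shift h5
      rw [hpQ]
      simpa using this)
  have rP' : res (y :: chS f [z] k) h P' = [k + 2] := by
    have : (res (y :: chS f [z] k) h P').Perm (res (y :: chS f [z] k) h (p ++ y :: Q1)) :=
      (hP'.filter _).map h
    rw [rp1] at this
    simpa using this
  have hv2 : res (y :: chS f [z] k) h (W ++ a :: V) =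
      [k + 2, k + 1] ++ res (y :: chS f [z] k) h R' := by
    rw [hv', res_append, rP', res_cons_mem hzS, hhz]
    rfl
  have hs' : s' = [k + 2, k + 1, h a, h b] := by
    have hW : res (y :: chS f [z] k) h W = [k + 2, k + 1] := by
      rw [res_append] at rP
      rw [res_append, res_cons_mem haS] at hv2
      rcases hw : res (y :: chS f [z] k) h W with _ | ⟨c, _ | ⟨d, _ | ⟨d', T⟩⟩⟩
      · exfalso
        rw [hw] at hv2
        simp at hv2
        have hay : a = y := hinj a haS y hyS' (by rw [hhy]; exact hv2.1)
        have hyW := not_mem_of_res_nil hw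
        have : y ∈ W ++ q := by rw [hpQ]; simp
        rcases List.mem_append.1 this with h4 | h4
        · exact hyW y h4 hyS'
        · exact haq (hay ▸ h4)
      · exfalso
        rw [hw] at hv2
        simp at hv2
        exact haz (hinj a haS z hzS (by rw [hhz]; exact hv2.2.1))
      · rw [hw] at rP
        simp at rP
        simp [rP.1, rP.2.1]
      · rw [hw] at rP
        simp at rP
    rw [res_append, res_cons_mem haS, hW] at h1
    have hl := h2.length_eq
    rcases s' with _ | ⟨c1, _ | ⟨c2, _ | ⟨c3, _ | ⟨c4, _ | ⟨c5, T⟩⟩⟩⟩⟩ <;> simp at hl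
    simp at h1
    obtain ⟨rfl, rfl, rfl, -⟩ := h1
    have h4 := h2.cons_inv.cons_inv.trans (List.Perm.swap (h a) (h b) [])
    have h5 := h4.cons_inv
    simp at h5
    rw [h5]
  rw [hs'] at h3
  rcases hbk with ⟨h4, h5⟩ | ⟨h4, h5⟩
  · rw [h4, h5] at h3
    exact h3
  · rw [h4, h5] at h3
    exact hθ.symm h3

theorem exists_min {Q P R : List ℕ} {k : ℕ} (h : ¬ ∀ a ∈ Q, dge k P R a) :
    ∃ m < k, (∀ a ∈ Q, dge m P R a) ∧ ∃ z ∈ Q, ¬ dge (m + 1) P R z := by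
  induction k with
  | zero => exact absurd (fun a _ => trivial) h
  | succ k ih =>
    by_cases h' : ∀ a ∈ Q, dge k P R a
    · push Not at h
      exact ⟨k, by omega, h', h⟩
    · obtain ⟨m, h1, h2⟩ := ih h'
      exact ⟨m, by omega, h2⟩

theorem swap12 (h : FIC χ) {k : ℕ} (he : Eta χ k) {p Q R : List ℕ} {x y : ℕ}
    (hx : dge k (p ++ y :: Q ++ [x, y]) R x)
    (hD : ∀ m < k, ∀ z ∈ Q, ¬ dge (k + 1) (p ++ y :: Q ++ [x, y]) R x →
      dge m (p ++ y :: Q ++ [x, y]) R z → ¬ dge (m + 1) (p ++ y :: Q ++ [x, y]) R z →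
      Delta χ k m) :
    χ (p ++ y :: Q ++ x :: y :: R) (p ++ y :: Q ++ y :: x :: R) := by
  by_cases h1 : dge (k + 1) (p ++ y :: Q ++ [x, y]) R x
  · exact swap12A h he (by simp) h1
  · by_cases h2 : ∀ a ∈ Q, dge k (p ++ y :: Q ++ [x, y]) R a
    · exact swap12B h he hx h2
    · obtain ⟨m, hm, h3, z, hz, h4⟩ := exists_min h2
      exact swap12D h (hD m hm z hz h1 (h3 z hz) h4) hx h3

theorem dge_swap {k P R x y a} (h : dge k (P ++ [x, y]) R a) : dge k (P ++ [y, x]) R a :=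
  dge_sub (fun c => (swap_perm P x y [] c).le) h

theorem swap_fin (hθ : FIC θ) (hP : HP θ) (hχ : FIC χ) {k : ℕ} (hη : Eta χ k)
    (hne : ∀ i < k, ¬ Eta θ i) (hβ : Beta θ k → Beta χ k) (hα : Alpha θ k → Alpha χ k)
    (hδ : ∀ m < k, Delta θ k m → Delta χ k m) {W q R V : List ℕ} {b a : ℕ}
    (e : θ (W ++ q ++ b :: a :: R) (W ++ a :: V)) (hu : Nrm (W ++ q ++ b :: a :: R))
    (hv : Nrm (W ++ a :: V)) (hab : a ≠ b) (haq : a ∉ q) :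
    χ (W ++ q ++ b :: a :: R) (W ++ q ++ a :: b :: R) := by
  have hA := agr_of hθ hP hne
  have hcount : ∀ c ∈ [b, a], (W ++ q).count c ≤ 1 := by
    intro c hc
    have h1 := hu c
    have h2 := count_pos_of hc
    have h3 : W ++ q ++ b :: a :: R = W ++ q ++ [b, a] ++ R := by simp
    rw [h3, List.count_append, List.count_append (l₂ := [b, a])] at h1
    omega
  have hsplit : ∀ y ∈ [b, a], y ∈ W ++ q → ∃ p Q, W ++ q = p ++ y :: Q ∧ y ∉ p ∧ y ∉ Q := by
    intro y hy hyP
    have h1 := hcount y hy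
    obtain ⟨p, Q, hpQ⟩ := List.append_of_mem hyP
    refine ⟨p, Q, hpQ, ?_, ?_⟩
    · intro hh
      rw [hpQ] at h1
      have := count_two (P := p) (q := y :: Q) hh (by simp)
      omega
    · intro hh
      rw [hpQ] at h1
      have := count_two (P := p ++ [y]) (q := Q) (a := y) (by simp) hh
      simp at this h1
      omega
  by_cases haP : a ∈ W ++ q
  · by_cases hbP : b ∈ W ++ q
    · exact hχ.swap22 hbP haP R
    · -- b is a first occurrence, a is a second one
      obtain ⟨p, Q, hpQ, hyp, hyQ⟩ := hsplit a (by simp) haP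
      have hb : dge k (W ++ q ++ [b, a]) R b := by
        have := dge_shift (s := [a]) (deep_b hA e hu hv hab haq hbP)
        simpa using this
      have := swap12 hχ hη (p := p) (Q := Q) (R := R) (x := b) (y := a) (by rw [← hpQ]; exact hb)
        (by
          intro m hm z hz h1 h2 h3
          rw [← hpQ] at h1 h2 h3
          exact hδ m hm (delta_of hθ hP hA e hu hv haq (Or.inl ⟨rfl, rfl⟩) hab.symm hpQ hyp hyQ
            hbP hm hb h1 hz h2 h3))
      rwa [← hpQ] at this
  · have ha := deep_a hA e hu hv hab haP
    by_cases hbP : b ∈ W ++ q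
    · obtain ⟨p, Q, hpQ, hyp, hyQ⟩ := hsplit b (by simp) hbP
      have := swap12 hχ hη (p := p) (Q := Q) (R := R) (x := a) (y := b)
        (by rw [← hpQ]; exact dge_swap ha)
        (by
          intro m hm z hz h1 h2 h3
          rw [← hpQ] at h1 h2 h3
          exact hδ m hm (delta_of hθ hP hA e hu hv haq (Or.inr ⟨rfl, rfl⟩) hab hpQ hyp hyQ
            haP hm ha (fun hh => h1 (dge_swap hh)) hz (dge_swap h2) (fun hh => h3 (dge_swap hh))))
      rw [← hpQ] at this
      exact hχ.symm this
    · have hb' := deep_b hA e hu hv hab haq hbP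
      have hb : dge k (W ++ q ++ [b, a]) R b := by
        have := dge_shift (s := [a]) hb'
        simpa using this
      have haW : a ∉ W := fun hh => haP (by simp [hh])
      have hbW : b ∉ W := fun hh => hbP (by simp [hh])
      by_cases h1 : dge (k + 1) (W ++ q ++ [b, a]) R a
      · by_cases h2 : dge (k + 1) (W ++ q ++ [b, a]) R b
        · exact swap11A hχ hη h2 h1
        · -- b exact
          have hbv : b ∈ W ++ a :: V := (hP _ _ e hu hv).mem_iff.1 (by simp)
          obtain ⟨P', c, R', hv', rfl, hP'⟩ := first_split (p := fun d => d = b) ⟨b, hbv, rfl⟩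
          have hcP' : c ∉ P' := fun hh => hP' c hh rfl
          have e1 := extraction hθ hP hA e hu hv rfl hbP hb' (by
            intro hh
            have := dge_shift (s := [a]) hh
            exact h2 (by simpa using this)) hv' hcP' hab
          have h3 := before_b hv' hab hbW
          rw [count_zero_of haP] at e1
          exact swap11B hχ (hβ (beta_of hθ e1 (count_le_of_app (hv' ▸ hv) a) (by omega))) hb h1
      · have hβ' : Beta χ k := by
          have e1 := extraction hθ hP hA e hu hv (P := W ++ q ++ [b]) (x := a) (R := R)
            (by simp) (by simp at haP ⊢; tauto) (by simpa using ha) (by simpa using h1) rfl haW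
            hab.symm
          rw [count_zero_of hbW, List.count_append, count_zero_of hbP] at e1
          apply hβ
          simpa [Beta] using e1
        by_cases h2 : dge (k + 1) (W ++ q ++ [b, a]) R b
        · exact hχ.symm (swap11B hχ hβ' (dge_swap ha) (dge_swap h2))
        · exact der_alpha hχ (hα (alpha_of hθ hP hA e hu hv hab haP hbP ha hb h1 h2)) hb ha

theorem swap_inf (hθ : FIC θ) (hP : HP θ) (hχ : FIC χ) (hne : ∀ i, ¬ Eta θ i)
    {W q R V : List ℕ} {b a : ℕ}
    (e : θ (W ++ q ++ b :: a :: R) (W ++ a :: V)) (hu : Nrm (W ++ q ++ b :: a :: R))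
    (hv : Nrm (W ++ a :: V)) (hab : a ≠ b) (haq : a ∉ q) :
    χ (W ++ q ++ b :: a :: R) (W ++ q ++ a :: b :: R) := by
  have hA := agr_of hθ hP (k := R.length + 1) (fun i _ => hne i)
  apply swapInf hχ (K := R.length + 1) (by omega)
  · by_cases hbP : b ∈ W ++ q
    · exact dge_of_count (count_two hbP (by simp))
    · have := dge_shift (s := [a]) (deep_b hA e hu hv hab haq hbP)
      simpa using this
  · by_cases haP : a ∈ W ++ q
    · exact dge_of_count (count_two haP (by simp))
    · exact deep_a hA e hu hv hab haP

/-! ### Bubble sort -/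

theorem bubble (hP : HP θ) (hθ : FIC θ) (hχ : FIC χ) (hle : ∀ u v, χ u v → θ u v)
    (hsw : ∀ (W q R V : List ℕ) (b a : ℕ), θ (W ++ q ++ b :: a :: R) (W ++ a :: V) →
      Nrm (W ++ q ++ b :: a :: R) → Nrm (W ++ a :: V) → a ≠ b → a ∉ q →
      χ (W ++ q ++ b :: a :: R) (W ++ q ++ a :: b :: R)) :
    ∀ (V W U : List ℕ), θ (W ++ U) (W ++ V) → Nrm (W ++ U) → Nrm (W ++ V) →
      χ (W ++ U) (W ++ V) := by
  intro V
  induction V with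
  | nil =>
    intro W U e hu hv
    have := (List.perm_append_left_iff W).1 (hP _ _ e hu hv)
    rw [List.perm_nil.1 this]
    exact hχ.refl _
  | cons a V ih =>
    intro W U e hu hv
    have hp := (List.perm_append_left_iff W).1 (hP _ _ e hu hv)
    obtain ⟨q0, a', R, rfl, rfl, hq0⟩ := first_split (p := fun d => d = a)
      ⟨a, hp.mem_iff.2 (by simp), rfl⟩
    have haq : a' ∉ q0 := fun hh => hq0 a' hh rfl
    have inner : ∀ (q0 R : List ℕ), a' ∉ q0 → θ (W ++ (q0 ++ a' :: R)) (W ++ a' :: V) →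
        Nrm (W ++ (q0 ++ a' :: R)) →
        χ (W ++ (q0 ++ a' :: R)) (W ++ a' :: (q0 ++ R)) := by
      intro q0
      induction q0 using List.reverseRecOn with
      | nil => intro R _ _ _; exact hχ.refl _
      | append_singleton q b ihq =>
        intro R h1 h2 h3
        simp only [List.mem_append, List.mem_singleton, not_or] at h1
        have e1 := hsw W q R V b a' (by simpa using h2) (by simpa using h3) hv h1.2 h1.1
        have e2 := hθ.trans (hθ.symm (hle _ _ e1)) (by simpa using h2)
        have hn : Nrm (W ++ (q ++ a' :: b :: R)) := by
          refine h3.perm ?_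
          simp only [List.append_assoc, List.cons_append, List.nil_append]
          exact List.Perm.append_left _ (List.Perm.append_left _ (List.Perm.swap _ _ _))
        have e3 := ihq (b :: R) h1.1 (by simpa using e2) hn
        simp at e1 e3 ⊢
        exact hχ.trans e1 e3
    have e1 := inner q0 R haq e hu
    have e2 := hθ.trans (hθ.symm (hle _ _ e1)) e
    have hn : Nrm (W ++ a' :: (q0 ++ R)) :=
      hu.perm (List.Perm.append_left _ List.perm_middle)
    have e3 := ih (W ++ [a']) (q0 ++ R) (by simpa using e2) (by simpa using hn) (by simpa using hv)
    simp at e3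
    exact hχ.trans e1 e3

end KHFB

namespace KHFB

variable {θ χ : List ℕ → List ℕ → Prop}

/-! ### Normal words -/

/-- Delete from `l` every occurrence of a letter that already occurred twice. -/
def redAux : List ℕ → List ℕ → List ℕ
  | _, [] => []
  | p, a :: l => if 2 ≤ p.count a then redAux p l else a :: redAux (p ++ [a]) l

theorem redAux_rel (h : FIC θ) (p l : List ℕ) : θ (p ++ l) (p ++ redAux p l) := by
  induction l generalizing p with
  | nil => exact h.refl _
  | cons a l ih =>
    unfold redAux
    split_ifs with ha
    · exact h.trans (h.symm (h.ins1 ha l)) (ih p)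
    · have := ih (p ++ [a])
      simpa using this

theorem redAux_nrm (p l : List ℕ) (hp : Nrm p) : Nrm (p ++ redAux p l) := by
  induction l generalizing p with
  | nil => simpa [redAux] using hp
  | cons a l ih =>
    unfold redAux
    split_ifs with ha
    · exact ih p hp
    · have := ih (p ++ [a]) (by
        intro c
        by_cases hc : c = a
        · subst hc; simp; omega
        · have := hp c
          rw [List.count_append, List.count_eq_zero_of_not_mem (l := [a]) (by simpa using hc)]
          omega)
      simpa using this

theorem red_rel (h : FIC θ) (l : List ℕ) : θ l (redAux [] l) := by
  simpa using redAux_rel h [] l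

theorem red_nrm (l : List ℕ) : Nrm (redAux [] l) := by
  simpa using redAux_nrm [] l (by intro c; simp)

theorem flat_count (c : ℕ) (u : List ℕ) :
    u.flatMap (fun i => if i = c then [0] else []) = List.replicate (u.count c) 0 := by
  induction u with
  | nil => rfl
  | cons a u ih =>
    rw [List.flatMap_cons, ih]
    by_cases h : a = c
    · subst h; simp [List.replicate_succ]
    · simp [h]

theorem pow_two (h : FIC θ) {n : ℕ} (hn : 2 ≤ n) : θ (List.replicate n 0) [0, 0] := by
  obtain ⟨m, rfl⟩ := Nat.exists_eq_add_of_le hn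
  have := h.ins (p := [0, 0]) (w := List.replicate m 0) (by
    intro a ha
    rw [List.eq_of_mem_replicate ha]
    simp) []
  rw [List.replicate_add]
  simpa [List.replicate_succ] using h.symm this

theorem case1 (h : FIC θ) {u v : List ℕ} {c : ℕ} (e : θ u v) (hu : c ∈ u) (hv : c ∉ v) :
    θ [0] [] := by
  have e1 := h.subst (fun i => if i = c then [0] else []) e
  rw [flat_count, flat_count, count_zero_of hv] at e1
  have hn := count_pos_of hu
  generalize u.count c = n at *
  have e2 := h.mul [0] [] e1
  have e3 := h.mul (List.replicate n 0) [] e1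
  have e4 := pow_two h (n := n + 1) (by omega)
  have e5 := pow_two h (n := n + n) (by omega)
  simp [← List.replicate_succ] at e2

  simp at e3 e1
  exact h.trans (h.symm e2) (h.trans e4 (h.trans (h.symm e5) (h.trans e3 e1)))

theorem case1_all (h : FIC χ) (e : χ [0] []) (u : List ℕ) : χ u [] := by
  induction u with
  | nil => exact h.refl _
  | cons a u ih =>
    have e1 := h.mul [] u (h.subst (fun _ => [a]) e)
    simp at e1
    exact h.trans e1 ih

theorem case2 (h : FIC θ) {u v : List ℕ} {c : ℕ} (e : θ u v) (hu : u.count c = 1)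
    (hv : 2 ≤ v.count c) : θ [0] [0, 0] := by
  have e1 := h.subst (fun i => if i = c then [0] else []) e
  rw [flat_count, flat_count, hu] at e1
  exact h.trans (by simpa using e1) (pow_two h hv)

theorem case2_all (h : FIC χ) (e : χ [0] [0, 0]) {u v : List ℕ} (huv : ∀ c, c ∈ u ↔ c ∈ v) :
    χ u v := by
  have sq : ∀ w, χ w (w ++ w) := by
    intro w
    have := h.subst (fun _ => w) e
    simpa using this
  have ab : ∀ p w : List ℕ, (∀ c ∈ w, c ∈ p) → χ p (p ++ w) := by
    intro p w hw
    have e1 := h.ins (p := p ++ p) (w := w) (fun a ha => count_two (hw a ha) (hw a ha)) []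
    have e2 := h.mul [] w (sq p)
    simp at e1 e2
    exact h.trans (sq p) (h.trans e1 (by simpa using h.symm e2))
  have cm : ∀ p w : List ℕ, χ (p ++ w) (p ++ (p ++ (w ++ w))) := by
    intro p w
    have e1 := h.mul [] w (sq p)
    have e2 := h.mul (p ++ p) [] (sq w)
    simp at e1 e2
    exact h.trans e1 e2
  exact h.trans (ab u v (fun c hc => (huv c).2 hc)) (h.trans (cm u v) (h.trans (h.k2 u v)
    (h.trans (h.symm (cm v u)) (h.symm (ab v u (fun c hc => (huv c).1 hc))))))

open Classical in
theorem abstract_main (h : FIC θ) : ∃ T : Finset (List ℕ × List ℕ), (∀ e ∈ T, θ e.1 e.2) ∧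
    ∀ χ : List ℕ → List ℕ → Prop, FIC χ → (∀ u v, χ u v → θ u v) → (∀ e ∈ T, χ e.1 e.2) →
      ∀ u v, θ u v → χ u v := by
  by_cases c1 : ∃ u v c, θ u v ∧ c ∈ u ∧ c ∉ v
  · obtain ⟨u, v, c, e, hu, hv⟩ := c1
    refine ⟨{([0], [])}, by simpa using case1 h e hu hv, ?_⟩
    intro χ hχ _ hT u v _
    have := hT ([0], []) (by simp)
    exact hχ.trans (case1_all hχ this u) (hχ.symm (case1_all hχ this v))
  have c1' : ∀ u v, θ u v → ∀ c, c ∈ u ↔ c ∈ v := by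
    intro u v e c
    constructor
    · intro hc; by_contra hv; exact c1 ⟨u, v, c, e, hc, hv⟩
    · intro hc; by_contra hv; exact c1 ⟨v, u, c, h.symm e, hc, hv⟩
  by_cases c2 : ∃ u v c, θ u v ∧ u.count c = 1 ∧ 2 ≤ v.count c
  · obtain ⟨u, v, c, e, hu, hv⟩ := c2
    refine ⟨{([0], [0, 0])}, by simpa using case2 h e hu hv, ?_⟩
    intro χ hχ _ hT u v e
    exact case2_all hχ (hT ([0], [0, 0]) (by simp)) (c1' u v e)
  have hP : HP θ := by
    intro u v e hu hv
    rw [List.perm_iff_count]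
    intro c
    have h1 := hu c
    have h2 := hv c
    have h3 := c1' u v e c
    rw [← List.count_pos_iff, ← List.count_pos_iff] at h3
    have h4 : ¬ (u.count c = 1 ∧ 2 ≤ v.count c) := fun hc => c2 ⟨u, v, c, e, hc⟩
    have h5 : ¬ (v.count c = 1 ∧ 2 ≤ u.count c) := fun hc => c2 ⟨v, u, c, h.symm e, hc⟩
    omega
  have fin : ∀ χ : List ℕ → List ℕ → Prop, FIC χ → (∀ u v, χ u v → θ u v) →
      (∀ (W q R V : List ℕ) (b a : ℕ), θ (W ++ q ++ b :: a :: R) (W ++ a :: V) →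
      Nrm (W ++ q ++ b :: a :: R) → Nrm (W ++ a :: V) → a ≠ b → a ∉ q →
      χ (W ++ q ++ b :: a :: R) (W ++ q ++ a :: b :: R)) → ∀ u v, θ u v → χ u v := by
    intro χ hχ hle hsw u v e
    have e1 := h.trans (h.symm (red_rel h u)) (h.trans e (red_rel h v))
    have := bubble hP h hχ hle hsw (redAux [] v) [] (redAux [] u) e1 (red_nrm u) (red_nrm v)
    exact hχ.trans (red_rel hχ u) (hχ.trans this (hχ.symm (red_rel hχ v)))
  by_cases hE : ∃ k, Eta θ k
  · obtain ⟨k, hk, hmin⟩ : ∃ k, Eta θ k ∧ ∀ i < k, ¬ Eta θ i :=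
      ⟨Nat.find hE, Nat.find_spec hE, fun i hi => Nat.find_min hE hi⟩
    refine ⟨(({(eW 2 k, eW 1 k), (eW 1 k, eW 0 k),
      ([k, k + 1] ++ cw k k, [k + 1, k] ++ cw k k)} : Finset (List ℕ × List ℕ)) ∪
      (Finset.range k).image (fun m => ([k + 2, k + 1, k, k + 2] ++ cw m k,
        [k + 2, k + 1, k + 2, k] ++ cw m k))).filter (fun e => θ e.1 e.2), ?_, ?_⟩
    · intro e he
      exact (Finset.mem_filter.1 he).2
    · intro χ hχ hle hT
      refine fin χ hχ hle ?_
      intro W q R V b a e hu hv hab haq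
      refine swap_fin h hP hχ (k := k) ?_ hmin ?_ ?_ ?_ e hu hv hab haq
      · exact hT (eW 2 k, eW 1 k) (Finset.mem_filter.2 ⟨by simp, hk⟩)
      · intro hb
        exact hT (eW 1 k, eW 0 k) (Finset.mem_filter.2 ⟨by simp, hb⟩)
      · intro hb
        exact hT ([k, k + 1] ++ cw k k, [k + 1, k] ++ cw k k)
          (Finset.mem_filter.2 ⟨by simp, hb⟩)
      · intro m hm hb
        refine hT ([k + 2, k + 1, k, k + 2] ++ cw m k, [k + 2, k + 1, k + 2, k] ++ cw m k)
          (Finset.mem_filter.2 ⟨Finset.mem_union_right _ (Finset.mem_image.2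
            ⟨m, Finset.mem_range.2 hm, rfl⟩), hb⟩)
  · refine ⟨∅, by simp, ?_⟩
    intro χ hχ hle _
    refine fin χ hχ hle ?_
    intro W q R V b a e hu hv hab haq
    exact swap_inf h hP hχ (fun i hi => hE ⟨i, hi⟩) e hu hv hab haq

/-! ### Monoids -/

theorem lift_flat {M : Type*} [Monoid M] (φ : Word →* M) (f : ℕ → List ℕ) (u : List ℕ) :
    φ (FreeMonoid.ofList (u.flatMap f)) =
      FreeMonoid.lift (fun i => φ (FreeMonoid.ofList (f i))) (FreeMonoid.ofList u) := by
  induction u with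
  | nil => rw [List.flatMap_nil, FreeMonoid.ofList_nil, map_one, map_one]
  | cons a u ih =>
    rw [List.flatMap_cons, FreeMonoid.ofList_append, map_mul, ih, FreeMonoid.ofList_cons,
      map_mul, FreeMonoid.lift_eval_of]

theorem sat_subst {M : Type*} [Monoid M] (f : ℕ → List ℕ) {u v : List ℕ}
    (h : MSat M (FreeMonoid.ofList u, FreeMonoid.ofList v)) :
    MSat M (FreeMonoid.ofList (u.flatMap f), FreeMonoid.ofList (v.flatMap f)) := by
  intro φ
  simp only
  rw [lift_flat, lift_flat]
  exact h _

theorem fic_sat {M : Type*} [Monoid M] (hM : SatAll M Kset) :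
    FIC (fun u v => MSat M (FreeMonoid.ofList u, FreeMonoid.ofList v)) where
  refl u φ := rfl
  symm h φ := (h φ).symm
  trans h1 h2 φ := (h1 φ).trans (h2 φ)
  mul p r h φ := by
    have := h φ
    simp only [FreeMonoid.ofList_append, map_mul] at this ⊢
    rw [this]
  subst f _ _ h := sat_subst f h
  k1 x y := by
    have := sat_subst (fun i => if i = 0 then x else y) (hM (wd [0,1,0], wd [0,1,0,0])
      (by simp [Kset]))
    simpa using this
  k2 x y := by
    have := sat_subst (fun i => if i = 0 then x else y) (hM (wd [0,0,1,1], wd [1,1,0,0])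
      (by simp [Kset]))
    simpa using this
  k3 x y := by
    have := sat_subst (fun i => if i = 0 then x else y) (hM (wd [0,0,1], wd [0,0,1,0])
      (by simp [Kset]))
    simpa using this

theorem FIC.and (h1 : FIC θ) (h2 : FIC χ) : FIC (fun u v => θ u v ∧ χ u v) where
  refl u := ⟨h1.refl u, h2.refl u⟩
  symm h := ⟨h1.symm h.1, h2.symm h.2⟩
  trans h h' := ⟨h1.trans h.1 h'.1, h2.trans h.2 h'.2⟩
  mul p r h := ⟨h1.mul p r h.1, h2.mul p r h.2⟩
  subst f _ _ h := ⟨h1.subst f h.1, h2.subst f h.2⟩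
  k1 x y := ⟨h1.k1 x y, h2.k1 x y⟩
  k2 x y := ⟨h1.k2 x y, h2.k2 x y⟩
  k3 x y := ⟨h1.k3 x y, h2.k3 x y⟩

theorem fic_theory (P : Set (Word × Word)) (hK : Kset ⊆ P) :
    FIC (fun u v => ∀ (M : Type*) [Monoid M], SatAll M P →
      MSat M (FreeMonoid.ofList u, FreeMonoid.ofList v)) := by
  have hf : ∀ (M : Type _) [Monoid M], SatAll M P →
      FIC (fun u v => MSat M (FreeMonoid.ofList u, FreeMonoid.ofList v)) :=
    fun M _ hM => fic_sat (fun e he => hM e (hK he))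
  exact
  { refl := fun u M _ hM => (hf M hM).refl u
    symm := fun h M _ hM => (hf M hM).symm (h M hM)
    trans := fun h h' M _ hM => (hf M hM).trans (h M hM) (h' M hM)
    mul := fun p r h M _ hM => (hf M hM).mul p r (h M hM)
    subst := fun f _ _ h M _ hM => (hf M hM).subst f (h M hM)
    k1 := fun x y M _ hM => (hf M hM).k1 x y
    k2 := fun x y M _ hM => (hf M hM).k2 x y
    k3 := fun x y M _ hM => (hf M hM).k3 x y }

end KHFB


/-- The variety `K = Mod {xyx ≈ xyx², x²y² ≈ y²x², x²y ≈ x²yx}` is hereditarily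
finitely based: every variety `Mod (Kset ∪ S)` is finitely based. -/
theorem K_is_hereditarily_finitely_based (S : Set (Word × Word)) :
    ∃ T : Finset (Word × Word), ∀ (M : Type uM) [Monoid M],
      SatAll M (Kset ∪ S) ↔ SatAll M (↑T) := by
  classical
  have hθ := KHFB.fic_theory.{uM} (Kset ∪ S) Set.subset_union_left
  obtain ⟨T, hT1, hT2⟩ := KHFB.abstract_main hθ
  have hfin : Kset.Finite := by simp [Kset]
  refine ⟨hfin.toFinset ∪ T.image (fun e => (FreeMonoid.ofList e.1, FreeMonoid.ofList e.2)), ?_⟩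
  intro M _
  constructor
  · intro hM e he
    rw [Finset.mem_coe, Finset.mem_union, Set.Finite.mem_toFinset, Finset.mem_image] at he
    rcases he with he | ⟨e0, he0, rfl⟩
    · exact hM e (Or.inl he)
    · exact hT1 e0 he0 M hM
  · intro hM e he
    have hK : SatAll M Kset := fun e he => hM e (by
      rw [Finset.mem_coe, Finset.mem_union, Set.Finite.mem_toFinset]; exact Or.inl he)
    have key := hT2 _ (hθ.and (KHFB.fic_sat hK)) (fun u v h => h.1) (fun e he =>
      ⟨hT1 e he, hM (FreeMonoid.ofList e.1, FreeMonoid.ofList e.2) (by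
        rw [Finset.mem_coe, Finset.mem_union, Finset.mem_image]
        exact Or.inr ⟨e, he, rfl⟩)⟩)
      (FreeMonoid.toList e.1) (FreeMonoid.toList e.2)
      (fun N _ hN => hN e he)
    exact key.2
end
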